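/- arXiv:2102.02195 — 2 statements merged into one kernel-verified Lean document; each statement's English description precedes it below -/
import Mathlib

section
/- For a generic endomorphism f of ℂⁿ (n ≥ 1), the Fatou set is forward invariant, f(F_f) ⊆ F_f, and in fact completely invariant: f⁻¹(F_f) = F_f. Consequently the Julia set is completely invariant as well: f⁻¹(J_f) = J_f and f(J_f) ⊆ J_f. (Proposition 2.11 of the paper, without the Runge claim, proved for Oka-Stein manifolds; specialized to ℂⁿ.) -/
open Function Topology Filter Metric

noncomputable section

/-- `ℂⁿ` as a Euclidean space. -/
abbrev Cn (n : ℕ) := EuclideanSpace ℂ (Fin n)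

/-- The space `End(ℂⁿ)` of holomorphic self-maps of `ℂⁿ`, topologized as a subspace of
the continuous maps `C(ℂⁿ, ℂⁿ)` with the compact-open topology. -/
abbrev Endo (n : ℕ) := {f : C(Cn n, Cn n) // Differentiable ℂ ⇑f}

variable {n : ℕ}

/-- The underlying function of an endomorphism. -/
def eapp (f : Endo n) : Cn n → Cn n := ⇑f.1

/-- `p` is a periodic point of `f`. -/
def IsPer (f : Endo n) (p : Cn n) : Prop := ∃ m, 1 ≤ m ∧ (eapp f)^[m] p = p

/-- The minimal period of a periodic point. -/
def minPer (f : Endo n) (p : Cn n) : ℕ := Function.minimalPeriod (eapp f) p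

/-- The eigenvalues at a periodic point `p`: the spectrum of the derivative of the
`minPer f p`-th iterate at `p`. -/
def eigs (f : Endo n) (p : Cn n) : Set ℂ := spectrum ℂ (fderiv ℂ ((eapp f)^[minPer f p]) p)

/-- Hyperbolic periodic point: no eigenvalue of absolute value 1. -/
def IsHypPer (f : Endo n) (p : Cn n) : Prop := IsPer f p ∧ ∀ z ∈ eigs f p, ‖z‖ ≠ 1

/-- Attracting periodic point: all eigenvalues of absolute value < 1. -/
def IsAttPer (f : Endo n) (p : Cn n) : Prop := IsPer f p ∧ ∀ z ∈ eigs f p, ‖z‖ < 1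

/-- Repelling periodic point: all eigenvalues of absolute value > 1. -/
def IsRepPer (f : Endo n) (p : Cn n) : Prop := IsPer f p ∧ ∀ z ∈ eigs f p, 1 < ‖z‖

/-- Saddle periodic point: hyperbolic with eigenvalues of absolute value both < 1 and > 1. -/
def IsSadPer (f : Endo n) (p : Cn n) : Prop :=
  IsHypPer f p ∧ (∃ z ∈ eigs f p, ‖z‖ < 1) ∧ (∃ z ∈ eigs f p, 1 < ‖z‖)

/-- Super-attracting periodic point: the derivative of the `minPer`-th iterate vanishes. -/
def IsSuperAttPer (f : Endo n) (p : Cn n) : Prop :=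
  IsPer f p ∧ fderiv ℂ ((eapp f)^[minPer f p]) p = 0

/-- The set of attracting periodic points of `f`. -/
def attSet (f : Endo n) : Set (Cn n) := {p | IsAttPer f p}

/-- The set of repelling periodic points of `f`. -/
def repSet (f : Endo n) : Set (Cn n) := {p | IsRepPer f p}

/-- The set of saddle periodic points of `f`. -/
def sadSet (f : Endo n) : Set (Cn n) := {p | IsSadPer f p}

/-- The robustly non-expelling set of `f`. -/
def rne (f : Endo n) : Set (Cn n) :=
  {p | ∃ U : Set (Cn n), IsOpen U ∧ p ∈ U ∧ ∃ V ∈ 𝓝 f, ∃ K : Set (Cn n),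
        IsCompact K ∧ ∀ g ∈ V, ∀ j : ℕ, (eapp g)^[j] '' U ⊆ K}

/-- A sequence of maps diverges locally uniformly to infinity on `U`. -/
def DivLocUnifOn (F : ℕ → Cn n → Cn n) (U : Set (Cn n)) : Prop :=
  ∀ L ⊆ U, IsCompact L → ∀ K : Set (Cn n), IsCompact K →
    ∀ᶠ j in atTop, Disjoint (F j '' L) K

/-- `p` belongs to the Fatou set of `f`: the iterates form a normal family near `p`. -/
def FatouAt (f : Endo n) (p : Cn n) : Prop :=
  ∃ U : Set (Cn n), IsOpen U ∧ p ∈ U ∧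
    ∀ k : ℕ → ℕ, StrictMono k → ∃ l : ℕ → ℕ, StrictMono l ∧
      ((∃ g : Cn n → Cn n, DifferentiableOn ℂ g U ∧
          TendstoLocallyUniformlyOn (fun j => (eapp f)^[k (l j)]) g atTop U) ∨
        DivLocUnifOn (fun j => (eapp f)^[k (l j)]) U)

/-- The Fatou set of `f`. -/
def Fatou (f : Endo n) : Set (Cn n) := {p | FatouAt f p}

/-- The Julia set of `f`. -/
def Julia (f : Endo n) : Set (Cn n) := (Fatou f)ᶜ

/-- The cycle (finite orbit) of a periodic point `p`. -/
def cycleOf (f : Endo n) (p : Cn n) : Set (Cn n) := {x | ∃ i < minPer f p, (eapp f)^[i] p = x}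

/-- The basin of attraction of the cycle of `p`. -/
def basinOf (f : Endo n) (p : Cn n) : Set (Cn n) :=
  {x | ∃ a ∈ cycleOf f p, Tendsto (fun k => (eapp f)^[minPer f p * k] x) atTop (𝓝 a)}

/-- The non-wandering set of `f`. -/
def nonWandering (f : Endo n) : Set (Cn n) :=
  {p | ∀ U ∈ 𝓝 p, ∃ k, 1 ≤ k ∧ (U ∩ (eapp f)^[k] '' U).Nonempty}

/-- The set of points whose orbit can be closed in the weak sense. -/
def cloSet (f : Endo n) : Set (Cn n) :=
  {p | ∀ U ∈ 𝓝 p, ∀ V ∈ 𝓝 f, ∃ g ∈ V, ∃ q ∈ U, IsPer g q}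

/-- `𝒯(m,K)`: endomorphisms all of whose periodic points in `K` of minimal period at most `m`
are transverse. -/
def TransSet (n : ℕ) (m : ℕ) (K : Set (Cn n)) : Set (Endo n) :=
  {f | ∀ p ∈ K, IsPer f p → minPer f p ≤ m → (1 : ℂ) ∉ eigs f p}

/-- `ℋ(m,K)`: endomorphisms all of whose periodic points in `K` of minimal period at most `m`
are hyperbolic. -/
def HypSet (n : ℕ) (m : ℕ) (K : Set (Cn n)) : Set (Endo n) :=
  {f | ∀ p ∈ K, IsPer f p → minPer f p ≤ m → ∀ z ∈ eigs f p, ‖z‖ ≠ 1}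

/-- The `m`-th iterate of an endomorphism as an endomorphism. -/
def iterEndo (f : Endo n) (m : ℕ) : Endo n :=
  ⟨⟨(eapp f)^[m], f.1.continuous.iterate m⟩, f.2.iterate m⟩

/-- The set of points with relatively compact forward orbit. -/
def boundedOrb (f : Endo n) : Set (Cn n) :=
  {p | ∃ K : Set (Cn n), IsCompact K ∧ ∀ k : ℕ, (eapp f)^[k] p ∈ K}

/-- An `ε`-chain (pseudo-orbit) of `f` from `x` to `y`. -/
def EpsChain (f : Endo n) (ε : Cn n → ℝ) (x y : Cn n) : Prop :=
  ∃ N : ℕ, 1 ≤ N ∧ ∃ c : ℕ → Cn n, c 0 = x ∧ c N = y ∧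
    ∀ j < N, dist (eapp f (c j)) (c (j + 1)) < ε (eapp f (c j))

/-- `x` and `y` are chain-equivalent for `f`. -/
def ChainEquiv (f : Endo n) (x y : Cn n) : Prop :=
  ∀ ε : Cn n → ℝ, Continuous ε → (∀ z, 0 < ε z) → EpsChain f ε x y ∧ EpsChain f ε y x

/-- `x` is chain-recurrent for `f`. -/
def ChainRec (f : Endo n) (x : Cn n) : Prop :=
  ∀ ε : Cn n → ℝ, Continuous ε → (∀ z, 0 < ε z) → EpsChain f ε x x

/-- Attracting fixed point. -/
def IsAttFix (f : Endo n) (p : Cn n) : Prop :=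
  eapp f p = p ∧ ∀ z ∈ spectrum ℂ (fderiv ℂ (eapp f) p), ‖z‖ < 1

/-- Repelling fixed point. -/
def IsRepFix (f : Endo n) (p : Cn n) : Prop :=
  eapp f p = p ∧ ∀ z ∈ spectrum ℂ (fderiv ℂ (eapp f) p), 1 < ‖z‖

/-- Saddle fixed point. -/
def IsSadFix (f : Endo n) (p : Cn n) : Prop :=
  eapp f p = p ∧ (∀ z ∈ spectrum ℂ (fderiv ℂ (eapp f) p), ‖z‖ ≠ 1) ∧
    (∃ z ∈ spectrum ℂ (fderiv ℂ (eapp f) p), ‖z‖ < 1) ∧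
    (∃ z ∈ spectrum ℂ (fderiv ℂ (eapp f) p), 1 < ‖z‖)

/-- `f` is a local biholomorphism at `p`: `f` agrees near `p` with a homeomorphism onto an
open set whose inverse is holomorphic. -/
def LocalBiholoAt (f : Endo n) (p : Cn n) : Prop :=
  ∃ φ : PartialHomeomorph (Cn n) (Cn n), p ∈ φ.source ∧ Set.EqOn (eapp f) φ φ.source ∧
    DifferentiableOn ℂ φ.symm φ.target


lemma lineAux (f : Cn n → Cn n) (hf : Differentiable ℂ f) (z v : Cn n) :
    HasDerivAt (fun s : ℂ => f (z + s • v)) (fderiv ℂ f z v) 0 := by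
  have h1 : HasDerivAt (fun s : ℂ => z + s • v) v 0 := by
    simpa using ((hasDerivAt_id (0 : ℂ)).smul_const v).const_add z
  have h2 : HasFDerivAt f (fderiv ℂ f z) ((fun s : ℂ => z + s • v) 0) := by
    simpa using (hf z).hasFDerivAt
  exact h2.comp_hasDerivAt (0 : ℂ) h1

/-- If a family of entire curves depends continuously on a parameter, so does the derivative. -/
lemma derivTendsto {α : Type*} {l : Filter α} (F : α → C(ℂ, Cn n)) (F0 : C(ℂ, Cn n))
    (hF : ∀ a, Differentiable ℂ (F a)) (hl : Tendsto F l (𝓝 F0)) :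
    Tendsto (fun a => deriv (F a) 0) l (𝓝 (deriv F0 0)) := by
  have h := ContinuousMap.tendsto_iff_tendstoLocallyUniformly.1 hl
  have h2 := (tendstoLocallyUniformlyOn_univ.2 h).deriv
    (Eventually.of_forall fun a => (hF a).differentiableOn) isOpen_univ
  exact h2.tendsto_at (Set.mem_univ 0)

lemma fderiv_apply_cont (f : Cn n → Cn n) (hf : Differentiable ℂ f) (v : Cn n) :
    Continuous (fun z => fderiv ℂ f z v) := by
  let G : C(Cn n × ℂ, Cn n) := ⟨fun x => f (x.1 + x.2 • v), hf.continuous.comp (by fun_prop)⟩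
  have hG : Continuous G.curry := G.curry.continuous
  rw [continuous_iff_continuousAt]
  intro z
  have key := derivTendsto (l := 𝓝 z) (fun a => G.curry a) (G.curry z)
    (fun a => by
      change Differentiable ℂ (fun s : ℂ => f (a + s • v))
      exact hf.comp (by fun_prop)) hG.continuousAt
  have e : ∀ a, deriv (G.curry a) 0 = fderiv ℂ f a v := fun a => (lineAux f hf a v).deriv
  simp only [e] at key
  exact key

lemma fderiv_cont (f : Cn n → Cn n) (hf : Differentiable ℂ f) : Continuous (fderiv ℂ f) :=
  continuous_clm_apply.2 (fderiv_apply_cont f hf)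

lemma strictAux (f : Cn n → Cn n) (hf : Differentiable ℂ f) (z : Cn n) :
    HasStrictFDerivAt f (fderiv ℂ f z) z :=
  hasStrictFDerivAt_of_hasFDerivAt_of_continuousAt
    (Eventually.of_forall fun x => (hf x).hasFDerivAt) (fderiv_cont f hf).continuousAt

lemma fderiv_line_diff (f : Cn n → Cn n) (hf : Differentiable ℂ f) (p q v : Cn n) :
    Differentiable ℂ (fun t : ℂ => fderiv ℂ f (p + t • q) v) := by
  rw [← differentiableOn_univ]
  have key : TendstoLocallyUniformlyOn
      (fun (s : ℂ) (t : ℂ) => s⁻¹ • (f (p + t • q + s • v) - f (p + t • q)))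
      (fun t : ℂ => fderiv ℂ f (p + t • q) v) (𝓝[≠] 0) Set.univ := by
    rw [tendstoLocallyUniformlyOn_univ, Metric.tendstoLocallyUniformly_iff]
    intro ε hε t0
    set z0 := p + t0 • q with hz0
    have hst := (strictAux f hf z0).isLittleO
    set c := ε / (4 * (‖v‖ + 1)) with hc
    have hcpos : 0 < c := by positivity
    have hb := hst.def hcpos
    have hb2 : ∀ᶠ x in 𝓝 (0 : ℂ) ×ˢ 𝓝 t0,
        ‖f (p + x.2 • q + x.1 • v) - f (p + x.2 • q) - fderiv ℂ f z0 (x.1 • v)‖ ≤ c * ‖x.1 • v‖ := by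
      rw [← nhds_prod_eq]
      have ht : Tendsto (fun x : ℂ × ℂ => (p + x.2 • q + x.1 • v, p + x.2 • q)) (𝓝 (0, t0))
          (𝓝 (z0, z0)) := by
        have : Continuous (fun x : ℂ × ℂ => (p + x.2 • q + x.1 • v, p + x.2 • q)) := by fun_prop
        have h := this.tendsto (0, t0)
        simpa [hz0] using h
      filter_upwards [ht.eventually hb] with x hx
      simpa using hx
    have hcont : ∀ᶠ t in 𝓝 t0, dist (fderiv ℂ f (p + t • q) v) (fderiv ℂ f z0 v) < ε / 2 := by
      have : Continuous (fun t : ℂ => fderiv ℂ f (p + t • q) v) :=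
        (fderiv_apply_cont f hf v).comp (by fun_prop)
      exact Metric.tendsto_nhds.1 this.continuousAt (ε / 2) (by positivity)
    obtain ⟨A, hA, B, hB, hAB⟩ := Filter.eventually_prod_iff.1 hb2
    refine ⟨{t | B t ∧ dist (fderiv ℂ f (p + t • q) v) (fderiv ℂ f z0 v) < ε / 2},
      hB.and hcont, ?_⟩
    filter_upwards [nhdsWithin_le_nhds hA, self_mem_nhdsWithin] with s hs hs0 t ht
    have hs0' : s ≠ 0 := hs0
    have h1 := hAB hs ht.1
    have h2 : dist (fderiv ℂ f z0 v) (s⁻¹ • (f (p + t • q + s • v) - f (p + t • q))) ≤ c * ‖v‖ := by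
      rw [dist_comm, dist_eq_norm]
      have e : s⁻¹ • (f (p + t • q + s • v) - f (p + t • q)) - fderiv ℂ f z0 v
          = s⁻¹ • (f (p + t • q + s • v) - f (p + t • q) - fderiv ℂ f z0 (s • v)) := by
        rw [map_smul, smul_sub s⁻¹ _ (s • _), inv_smul_smul₀ hs0']
      rw [e, norm_smul, norm_inv]
      have hsn : 0 < ‖s‖ := norm_pos_iff.2 hs0'
      rw [norm_smul] at h1
      rw [inv_mul_le_iff₀ hsn]
      linarith
    have h3 : c * ‖v‖ ≤ ε / 4 := by
      rw [hc, div_mul_eq_mul_div, div_le_iff₀ (by positivity)]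
      nlinarith [norm_nonneg v]
    calc _ ≤ _ := dist_triangle _ (fderiv ℂ f z0 v) _
      _ < ε := by linarith [ht.2]
  refine key.differentiableOn (Eventually.of_forall fun s => ?_) isOpen_univ
  refine Differentiable.differentiableOn ?_
  have d1 : Differentiable ℂ (fun t : ℂ => f (p + t • q + s • v)) := hf.comp (by fun_prop)
  have d2 : Differentiable ℂ (fun t : ℂ => f (p + t • q)) := hf.comp (by fun_prop)
  exact (d1.sub d2).const_smul s⁻¹

/-- Jacobian determinant. -/
def jac (f : Cn n → Cn n) (z : Cn n) : ℂ :=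
  (Matrix.of fun i j : Fin n => (fderiv ℂ f z (EuclideanSpace.single j 1)) i).det

lemma jac_line_diff (f : Cn n → Cn n) (hf : Differentiable ℂ f) (p q : Cn n) :
    Differentiable ℂ (fun t : ℂ => jac f (p + t • q)) := by
  have h : ∀ i j : Fin n, Differentiable ℂ
      (fun t : ℂ => (fderiv ℂ f (p + t • q) (EuclideanSpace.single j 1)) i) := fun i j =>
    (differentiable_euclidean.1 (fderiv_line_diff f hf p q (EuclideanSpace.single j 1))) i
  unfold jac
  simp only [Matrix.det_apply, Matrix.of_apply]
  refine Differentiable.fun_sum fun σ _ => ?_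
  refine Differentiable.const_smul ?_ _
  exact Differentiable.fun_finsetProd fun i _ => h _ _

lemma jac_eq_det (f : Cn n → Cn n) (z : Cn n) : jac f z = (fderiv ℂ f z).det := by
  have := LinearMap.det_toMatrix (EuclideanSpace.basisFun (Fin n) ℂ).toBasis
    (fderiv ℂ f z : Cn n →ₗ[ℂ] Cn n)
  rw [ContinuousLinearMap.det, ← this]
  unfold jac
  congr 1

lemma jac_nhds (f : Cn n → Cn n) (hf : Differentiable ℂ f) (z : Cn n) (hz : jac f z ≠ 0) :
    map f (𝓝 z) = 𝓝 (f z) := by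
  rw [jac_eq_det] at hz
  refine (strictAux f hf z).map_nhds_eq_of_surj ?_
  have hu : IsUnit (LinearMap.det (fderiv ℂ f z : Cn n →ₗ[ℂ] Cn n)) := isUnit_iff_ne_zero.2 hz
  have hu2 := (LinearMap.isUnit_iff_isUnit_det _).2 hu
  exact (LinearMap.isUnit_iff_range_eq_top _).1 hu2

lemma main_ext (f : Cn n → Cn n) (hf : Differentiable ℂ f) (h0 : jac f 0 ≠ 0)
    (U : Set (Cn n)) (hU : IsOpen U) (p : Cn n) (hp : p ∈ U) :
    ∃ r > 0, ∃ L ⊆ U, IsCompact L ∧ ∀ (h : Cn n → Cn n), Differentiable ℂ h → ∀ M : ℝ,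
      (∀ x ∈ L, ‖h (f x)‖ ≤ M) → ∀ w ∈ ball (f p) r, ‖h w‖ ≤ M := by
  have hJ := jac_line_diff f hf p (-p)
  have hJ1 : jac f (p + (1 : ℂ) • (-p)) ≠ 0 := by simpa using h0
  have hev : ∀ᶠ t in 𝓝[≠] (0 : ℂ), jac f (p + t • (-p)) ≠ 0 := by
    have hA : AnalyticOnNhd ℂ (fun t : ℂ => jac f (p + t • (-p))) Set.univ :=
      fun t _ => hJ.analyticAt t
    rcases (hA 0 (Set.mem_univ _)).eventually_eq_zero_or_eventually_ne_zero with h | h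
    · exfalso
      have := hA.eqOn_zero_of_preconnected_of_eventuallyEq_zero isPreconnected_univ
        (Set.mem_univ 0) h
      exact hJ1 (this (Set.mem_univ 1))
    · exact h
  have hcγ : Continuous (fun t : ℂ => p + t • (-p)) := by fun_prop
  have hUe : ∀ᶠ t in 𝓝 (0 : ℂ), p + t • (-p) ∈ U :=
    hcγ.continuousAt.eventually (hU.mem_nhds (by simpa using hp))
  obtain ⟨ρ0, hρ0, hball⟩ := Metric.mem_nhds_iff.1 (hUe.and (eventually_nhdsWithin_iff.1 hev))
  set ρ := ρ0 / 2 with hρ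
  have hρpos : 0 < ρ := by positivity
  have hsph : ∀ t ∈ sphere (0 : ℂ) ρ, p + t • (-p) ∈ U ∧ jac f (p + t • (-p)) ≠ 0 := by
    intro t ht
    have ht' : ‖t‖ = ρ := by simpa using ht
    have hm : t ∈ ball (0 : ℂ) ρ0 := by
      rw [mem_ball_zero_iff, ht']; linarith
    have := hball hm
    refine ⟨this.1, this.2 ?_⟩
    intro h
    have : t = 0 := h
    rw [this, norm_zero] at ht'
    linarith
  set S := (fun t : ℂ => p + t • (-p)) '' sphere (0 : ℂ) ρ with hS
  have hSc : IsCompact S := (isCompact_sphere _ _).image hcγ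
  have hSU : S ⊆ U := by rintro _ ⟨t, ht, rfl⟩; exact (hsph t ht).1
  obtain ⟨δ, hδ, hδU⟩ := hSc.exists_cthickening_subset_open hU hSU
  have hLc : IsCompact (cthickening δ S) := hSc.cthickening
  have hfS : f '' S ⊆ interior (f '' cthickening δ S) := by
    rintro _ ⟨_, ⟨t, ht, rfl⟩, rfl⟩
    rw [mem_interior_iff_mem_nhds]
    have hz := jac_nhds f hf _ (hsph t ht).2
    simp only
    rw [← hz]
    refine image_mem_map ?_
    exact mem_of_superset (isOpen_thickening.mem_nhds
      (self_subset_thickening hδ S ⟨t, ht, rfl⟩)) (thickening_subset_cthickening _ _)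
  obtain ⟨r, hr, hrU⟩ := (hSc.image hf.continuous).exists_thickening_subset_open
    isOpen_interior hfS
  refine ⟨r, hr, cthickening δ S, hδU, hLc, ?_⟩
  intro h hh M hM w hw
  have hd : Differentiable ℂ (fun t : ℂ => h (f (p + t • (-p)) + (w - f p))) := by
    have d2 : Differentiable ℂ (fun t : ℂ => f (p + t • (-p))) := hf.comp (by fun_prop)
    exact hh.comp (d2.add_const _)
  have := Complex.norm_le_of_forall_mem_frontier_norm_le (U := ball (0 : ℂ) ρ) (C := M)
    isBounded_ball hd.diffContOnCl (fun t ht => ?_) (subset_closure (mem_ball_self hρpos))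
  · simpa using this
  · rw [frontier_ball _ hρpos.ne'] at ht
    have hm : f (p + t • (-p)) + (w - f p) ∈ thickening r (f '' S) := by
      rw [mem_thickening_iff]
      refine ⟨f (p + t • (-p)), ⟨_, ⟨t, ht, rfl⟩, rfl⟩, ?_⟩
      rw [mem_ball, dist_eq_norm] at hw
      rw [dist_eq_norm]
      simpa using hw
    obtain ⟨x, hx, hxe⟩ := interior_subset (hrU hm)
    rw [← hxe]
    exact hM x hx

lemma fderiv_bound (h : Cn n → Cn n) (hh : Differentiable ℂ h) (z : Cn n) (r M : ℝ) (hr : 0 < r)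
    (hM : 0 ≤ M) (hb : ∀ w ∈ closedBall z r, ‖h w‖ ≤ M) : ‖fderiv ℂ h z‖ ≤ M / r := by
  refine ContinuousLinearMap.opNorm_le_bound _ (by positivity) fun v => ?_
  by_cases hv : v = 0
  · simp [hv]
  have hvn : 0 < ‖v‖ := norm_pos_iff.2 hv
  have hd : Differentiable ℂ (fun s : ℂ => h (z + s • v)) := hh.comp (by fun_prop)
  have := Complex.norm_deriv_le_of_forall_mem_sphere_norm_le (c := (0 : ℂ)) (R := r / ‖v‖) (C := M)
    (by positivity) hd.diffContOnCl (fun s hs => hb _ ?_)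
  · rw [(lineAux h hh z v).deriv] at this
    calc _ ≤ _ := this
      _ = _ := by field_simp
  · have hs' : ‖s‖ = r / ‖v‖ := by simpa using hs
    rw [mem_closedBall, dist_eq_norm]
    simp only [add_sub_cancel_left, norm_smul, hs']
    rw [div_mul_cancel₀ _ hvn.ne']

lemma limit_diff (F : ℕ → Cn n → Cn n) (hF : ∀ j, Differentiable ℂ (F j)) (q : Cn n) (r : ℝ)
    (hr : 0 < r) (hC : UniformCauchySeqOn F atTop (ball q (2 * r))) :
    ∃ g : Cn n → Cn n, DifferentiableOn ℂ g (ball q r) ∧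
      TendstoLocallyUniformlyOn F g atTop (ball q r) := by
  have hsub : ball q r ⊆ ball q (2 * r) := ball_subset_ball (by linarith)
  have hex : ∀ x, ∃ y, x ∈ ball q r → Tendsto (fun j => F j x) atTop (𝓝 y) := by
    intro x
    by_cases hx : x ∈ ball q r
    · obtain ⟨y, hy⟩ := cauchySeq_tendsto_of_complete (hC.cauchy_map (hsub hx))
      exact ⟨y, fun _ => hy⟩
    · exact ⟨0, fun h => absurd h hx⟩
  choose g hg using hex
  have hlim : TendstoUniformlyOn F g atTop (ball q r) :=
    (hC.mono hsub).tendstoUniformlyOn_of_tendsto fun x hx => hg x hx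
  have hDC : UniformCauchySeqOn (fun j => fderiv ℂ (F j)) atTop (ball q r) := by
    rw [Metric.uniformCauchySeqOn_iff] at hC ⊢
    intro ε hε
    obtain ⟨N, hN⟩ := hC (ε * r / 4) (by positivity)
    refine ⟨N, fun a ha b hb x hx => ?_⟩
    have hd : Differentiable ℂ (F a - F b) := (hF a).sub (hF b)
    have := fderiv_bound (F a - F b) hd x (r / 2) (ε * r / 4) (by positivity) (by positivity) ?_
    · rw [fderiv_sub (hF a x) (hF b x)] at this
      rw [dist_eq_norm]
      refine this.trans_lt ?_
      rw [div_lt_iff₀ (by positivity)]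
      nlinarith [mul_pos hε hr]
    · intro w hw
      have hw2 : w ∈ ball q (2 * r) := by
        rw [mem_ball] at hx ⊢
        rw [mem_closedBall] at hw
        linarith [dist_triangle w x q]
      have := hN a ha b hb w hw2
      rw [dist_eq_norm] at this
      exact this.le
  have hex' : ∀ x, ∃ y, x ∈ ball q r → Tendsto (fun j => fderiv ℂ (F j) x) atTop (𝓝 y) := by
    intro x
    by_cases hx : x ∈ ball q r
    · obtain ⟨y, hy⟩ := cauchySeq_tendsto_of_complete (hDC.cauchy_map hx)
      exact ⟨y, fun _ => hy⟩
    · exact ⟨0, fun h => absurd h hx⟩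
  choose g' hg' using hex'
  have hlim' : TendstoUniformlyOn (fun j => fderiv ℂ (F j)) g' atTop (ball q r) :=
    hDC.tendstoUniformlyOn_of_tendsto fun x hx => hg' x hx
  refine ⟨g, fun x hx => ?_, hlim.tendstoLocallyUniformlyOn⟩
  exact (hasFDerivAt_of_tendstoUniformlyOn isOpen_ball hlim'
    (fun j y _ => (hF j y).hasFDerivAt) (fun y hy => hg y hy) hx).differentiableAt.differentiableWithinAt

lemma fatou_forward (f : Endo n) (h0 : jac (eapp f) 0 ≠ 0) (hb : Dense (boundedOrb f))
    (p : Cn n) (hp : p ∈ Fatou f) : eapp f p ∈ Fatou f := by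
  obtain ⟨U, hU, hpU, hk⟩ := hp
  have hf : Differentiable ℂ (eapp f) := f.2
  obtain ⟨r, hr, L, hLU, hLc, hL⟩ := main_ext (eapp f) hf h0 U hU p hpU
  refine ⟨ball (eapp f p) (r / 2), isOpen_ball, mem_ball_self (by positivity), ?_⟩
  intro k hkm
  obtain ⟨l, hl, hcase⟩ := hk (fun j => k j + 1) (fun a b hab => by have := hkm hab; simp only; omega)
  refine ⟨l, hl, ?_⟩
  rcases hcase with ⟨g, hg, hlim⟩ | hdiv
  · left
    refine limit_diff _ (fun j => hf.iterate _) _ _ (by positivity) ?_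
    have e : 2 * (r / 2) = r := by ring
    rw [e]
    have hu : TendstoUniformlyOn (fun j => (eapp f)^[k (l j) + 1]) g atTop L :=
      (tendstoLocallyUniformlyOn_iff_forall_isCompact hU).1 hlim L hLU hLc
    have hc := hu.uniformCauchySeqOn
    rw [Metric.uniformCauchySeqOn_iff] at hc ⊢
    intro ε hε
    obtain ⟨N, hN⟩ := hc (ε / 2) (by positivity)
    refine ⟨N, fun a ha b hb x hx => ?_⟩
    have := hL ((eapp f)^[k (l a)] - (eapp f)^[k (l b)])
      ((hf.iterate _).sub (hf.iterate _)) (ε / 2) ?_ x hx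
    · rw [dist_eq_norm]
      simp only [Pi.sub_apply] at this
      linarith
    · intro y hy
      have := hN a ha b hb y hy
      rw [dist_eq_norm] at this
      simp only [Function.iterate_succ_apply] at this
      exact this.le
  · exfalso
    obtain ⟨z, ⟨K, hK, hzK⟩, hzU⟩ := hb.exists_mem_open hU ⟨p, hpU⟩ |>.imp fun _ h => h
    have := (hdiv {z} (by simpa using hzU) isCompact_singleton K hK).exists
    obtain ⟨j, hj⟩ := this
    rw [Set.image_singleton, Set.disjoint_singleton_left] at hj
    exact hj (hzK _)

lemma fatou_backward (f : Endo n) (p : Cn n) (hp : eapp f p ∈ Fatou f) : p ∈ Fatou f := by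
  obtain ⟨W, hW, hpW, hk⟩ := hp
  have hf : Differentiable ℂ (eapp f) := f.2
  refine ⟨eapp f ⁻¹' W, hW.preimage hf.continuous, hpW, ?_⟩
  intro k hkm
  have hk1 : ∀ j, 1 ≤ k (j + 1) := fun j => by
    have := hkm (Nat.lt_succ_self j); simp only [Nat.succ_eq_add_one] at this; omega
  obtain ⟨l, hl, hcase⟩ := hk (fun j => k (j + 1) - 1) (fun a b hab => by
    have h1 := hkm (Nat.succ_lt_succ hab)
    have h2 := hk1 a
    simp only [Nat.succ_eq_add_one] at *
    omega)
  refine ⟨fun j => l j + 1, fun a b hab => by have := hl hab; simp only; omega, ?_⟩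
  have e : ∀ j, (eapp f)^[k (l j + 1)] = (eapp f)^[k (l j + 1) - 1] ∘ eapp f := fun j => by
    rw [← Function.iterate_succ, Nat.succ_eq_add_one, Nat.sub_add_cancel (hk1 _)]
  simp only [e]
  rcases hcase with ⟨g, hg, hlim⟩ | hdiv
  · left
    refine ⟨g ∘ eapp f, hg.comp hf.differentiableOn (fun x hx => hx), ?_⟩
    exact hlim.comp (eapp f) (fun x hx => hx) hf.continuous.continuousOn
  · right
    intro L hL hLc K hK
    filter_upwards [hdiv (eapp f '' L) (by rintro _ ⟨x, hx, rfl⟩; exact hL hx)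
      (hLc.image hf.continuous) K hK] with j hj
    rwa [Set.image_comp]

lemma tendsto_endo {α : Type*} {l : Filter α} (F : α → Endo n) (f : Endo n)
    (h : ∀ K : Set (Cn n), IsCompact K → TendstoUniformlyOn (fun a => eapp (F a)) (eapp f) l K) :
    Tendsto F l (𝓝 f) := by
  rw [tendsto_subtype_rng]
  exact ContinuousMap.tendsto_iff_forall_isCompact_tendstoUniformlyOn.2 h

lemma fderiv_endo_cont (z v : Cn n) : Continuous (fun g : Endo n => fderiv ℂ (eapp g) z v) := by
  rw [continuous_iff_continuousAt]
  intro g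
  let γ : C(ℂ, Cn n) := ⟨fun s => z + s • v, by fun_prop⟩
  have hc : Continuous (fun g : Endo n => g.1.comp γ) :=
    (ContinuousMap.continuous_precomp γ).comp continuous_subtype_val
  have key := derivTendsto (l := 𝓝 g) (fun g : Endo n => g.1.comp γ) (g.1.comp γ)
    (fun a => by
      change Differentiable ℂ (fun s : ℂ => a.1 (z + s • v))
      exact a.2.comp (by fun_prop)) hc.continuousAt
  have e : ∀ a : Endo n, deriv (a.1.comp γ) 0 = fderiv ℂ (eapp a) z v :=
    fun a => (lineAux (eapp a) a.2 z v).deriv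
  simp only [e] at key
  exact key

lemma jac_open : IsOpen {f : Endo n | jac (eapp f) 0 ≠ 0} := by
  have : Continuous (fun f : Endo n => jac (eapp f) 0) := by
    unfold jac
    refine Continuous.matrix_det ?_
    refine continuous_matrix fun i j => ?_
    have := fderiv_endo_cont (n := n) 0 (EuclideanSpace.single j 1)
    simp only [Matrix.of_apply]
    exact (EuclideanSpace.proj (𝕜 := ℂ) i).continuous.comp this
  exact isOpen_ne_fun this continuous_const

/-- perturbation by a multiple of the identity -/
def addId (f : Endo n) (ε : ℂ) : Endo n :=
  ⟨⟨fun z => eapp f z + ε • z, f.1.continuous.add (by fun_prop)⟩,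
    Differentiable.add f.2 (by fun_prop)⟩

lemma jac_dense : Dense {f : Endo n | jac (eapp f) 0 ≠ 0} := by
  intro f
  have hf : Differentiable ℂ (eapp f) := f.2
  have ht : Tendsto (addId f) (𝓝[≠] 0) (𝓝 f) := by
    refine tendsto_endo _ _ fun K hK => ?_
    obtain ⟨R, hR⟩ := hK.isBounded.exists_norm_le
    rw [Metric.tendstoUniformlyOn_iff]
    intro ε hε
    have : ∀ᶠ t in 𝓝[≠] (0 : ℂ), ‖t‖ < ε / (|R| + 1) := by
      refine nhdsWithin_le_nhds ?_
      have := Metric.ball_mem_nhds (0 : ℂ) (show 0 < ε / (|R| + 1) by positivity)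
      simpa [Metric.ball, dist_zero_right] using this
    filter_upwards [this] with t ht x hx
    rw [dist_eq_norm]
    have e : eapp f x - eapp (addId f t) x = - (t • x) := by
      simp [eapp, addId]
    rw [e, norm_neg, norm_smul]
    rw [lt_div_iff₀ (by positivity)] at ht
    have h1 := hR x hx
    have h2 : ‖x‖ ≤ |R| + 1 := by linarith [le_abs_self R]
    calc _ ≤ ‖t‖ * (|R| + 1) := by gcongr
      _ < ε := ht
  refine mem_closure_of_tendsto ht ?_ |> fun h => h
  have hfd : ∀ t : ℂ, fderiv ℂ (eapp (addId f t)) 0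
      = fderiv ℂ (eapp f) 0 + t • ContinuousLinearMap.id ℂ (Cn n) := by
    intro t
    have h1 := (hf 0).hasFDerivAt
    have h2 : HasFDerivAt (fun z : Cn n => t • z) (t • ContinuousLinearMap.id ℂ (Cn n)) 0 :=
      (hasFDerivAt_id (𝕜 := ℂ) (0 : Cn n)).const_smul t
    exact (h1.add h2).fderiv
  set A : Matrix (Fin n) (Fin n) ℂ := Matrix.of fun i j : Fin n =>
    (fderiv ℂ (eapp f) 0 (EuclideanSpace.single j 1)) i with hA
  have hj : ∀ t : ℂ, jac (eapp (addId f t)) 0 = ((-A).charpoly).eval t := by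
    intro t
    rw [Matrix.eval_charpoly]
    unfold jac
    congr 1
    ext i j
    rw [hfd]
    simp [hA, Matrix.scalar_apply, Matrix.diagonal_apply, Pi.single_apply, add_comm]
  have hfin : {t : ℂ | ((-A).charpoly).eval t = 0}.Finite :=
    Polynomial.finite_setOf_isRoot (Matrix.charpoly_monic _).ne_zero
  have hopen : {t : ℂ | ((-A).charpoly).eval t = 0 ∧ t ≠ 0}ᶜ ∈ 𝓝 (0 : ℂ) :=
    (hfin.subset fun t ht => ht.1).isClosed.isOpen_compl.mem_nhds (by simp)
  filter_upwards [nhdsWithin_le_nhds hopen, self_mem_nhdsWithin] with t h1 h2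
  intro h3
  rw [hj] at h3
  exact h1 ⟨h3, h2⟩

/-- The open set of maps with a point of `B` trapped by a ball. -/
def trapSet (B : Set (Cn n)) : Set (Endo n) :=
  {g | ∃ z ∈ B, ∃ N : ℕ, ∃ c : Cn n, ∃ r : ℝ, (eapp g)^[N] z ∈ ball c r ∧
    Set.MapsTo (eapp g) (closedBall c r) (ball c r)}

lemma iter_cont (N : ℕ) (z : Cn n) : Continuous (fun g : Endo n => (eapp g)^[N] z) := by
  induction N with
  | zero => simpa using continuous_const
  | succ N ih =>
    simp only [Function.iterate_succ_apply']
    have : Continuous (fun g : Endo n => g.1 ((eapp g)^[N] z)) := by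
      exact Continuous.eval continuous_subtype_val ih
    exact this

lemma trap_open (B : Set (Cn n)) : IsOpen (trapSet B) := by
  have : trapSet B = ⋃ z ∈ B, ⋃ N : ℕ, ⋃ c : Cn n, ⋃ r : ℝ,
      ({g : Endo n | (eapp g)^[N] z ∈ ball c r} ∩
        {g : Endo n | Set.MapsTo (eapp g) (closedBall c r) (ball c r)}) := by
    ext g
    simp [trapSet]
  rw [this]
  refine isOpen_biUnion fun z _ => isOpen_iUnion fun N => isOpen_iUnion fun c =>
    isOpen_iUnion fun r => ?_
  refine (isOpen_ball.preimage (iter_cont N z)).inter ?_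
  exact (ContinuousMap.isOpen_setOf_mapsTo (isCompact_closedBall c r) isOpen_ball).preimage
    continuous_subtype_val

lemma trap_bounded (B : Set (Cn n)) (g : Endo n) (hg : g ∈ trapSet B) :
    ∃ z ∈ B, z ∈ boundedOrb g := by
  obtain ⟨z, hz, N, c, r, h1, h2⟩ := hg
  refine ⟨z, hz, closedBall c r ∪ (fun k => (eapp g)^[k] z) '' (Finset.range N : Set ℕ),
    (isCompact_closedBall c r).union ((Finset.range N).finite_toSet.image _).isCompact, ?_⟩
  have key : ∀ m, (eapp g)^[N + m] z ∈ ball c r := by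
    intro m
    induction m with
    | zero => simpa using h1
    | succ m ih =>
      rw [← add_assoc, Function.iterate_succ_apply']
      exact h2 (ball_subset_closedBall ih)
  intro k
  by_cases hk : k < N
  · right
    exact ⟨k, by simpa using hk, rfl⟩
  · left
    have := key (k - N)
    rw [Nat.add_sub_cancel' (not_lt.1 hk)] at this
    exact ball_subset_closedBall this

/-- scalar functions small on a ball, vanishing at given points, equal to 1 at `a`. -/
lemma exists_chi (R : ℝ) (hR : 0 ≤ R) (a : Cn n) (ha : R < ‖a‖) (N : ℕ) (x : ℕ → Cn n)
    (hx : ∀ i < N, x i ≠ a) (ε : ℝ) (hε : 0 < ε) :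
    ∃ χ : Cn n → ℂ, Differentiable ℂ χ ∧ χ a = 1 ∧ (∀ i < N, χ (x i) = 0) ∧
      ∀ z ∈ closedBall (0 : Cn n) R, ‖χ z‖ ≤ ε := by
  let P : Cn n → ℂ := fun z => ∏ i ∈ Finset.range N,
    (inner ℂ (a - x i) (z - x i) / inner ℂ (a - x i) (a - x i))
  have hP : Differentiable ℂ P := by
    have d : ∀ i, Differentiable ℂ (fun z : Cn n =>
        (inner ℂ (a - x i) (z - x i) / inner ℂ (a - x i) (a - x i) : ℂ)) := fun i => by
      have d1 : Differentiable ℂ (fun z : Cn n => (inner ℂ (a - x i) (z - x i) : ℂ)) :=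
        (innerSL ℂ (a - x i)).differentiable.comp (differentiable_id.sub_const (x i))
      simp only [div_eq_mul_inv]
      exact d1.mul_const _
    have d2 : ∀ m : ℕ, Differentiable ℂ (fun z : Cn n => ∏ i ∈ Finset.range m,
        (inner ℂ (a - x i) (z - x i) / inner ℂ (a - x i) (a - x i) : ℂ)) := fun m => by
      induction m with
      | zero => simp
      | succ m ih =>
        simp only [Finset.prod_range_succ]
        exact ih.mul (d m)
    exact d2 N
  have hPa : P a = 1 := by
    refine Finset.prod_eq_one fun i hi => div_self ?_
    rw [inner_self_ne_zero, sub_ne_zero]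
    exact (hx i (Finset.mem_range.1 hi)).symm
  have hPx : ∀ i < N, P (x i) = 0 := fun i hi =>
    Finset.prod_eq_zero (Finset.mem_range.2 hi) (by simp)
  obtain ⟨C, hC⟩ := (isCompact_closedBall (0 : Cn n) R).exists_bound_of_continuousOn
    hP.continuous.continuousOn
  set δ := ‖a‖ * (‖a‖ - R) with hδ
  have hδpos : 0 < δ := mul_pos (by linarith) (by linarith)
  have hlim : Tendsto (fun m : ℕ => (|C| + 1) * (Real.exp (-δ)) ^ m) atTop (𝓝 0) := by
    have := (tendsto_pow_atTop_nhds_zero_of_lt_one (Real.exp_pos (-δ)).le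
      (by rw [Real.exp_lt_one_iff]; linarith)).const_mul (|C| + 1)
    simpa using this
  obtain ⟨m, hm⟩ := (hlim.eventually (gt_mem_nhds hε)).exists
  let E : Cn n → ℂ := fun z => Complex.exp (m * (inner ℂ a z - inner ℂ a a))
  have hE : Differentiable ℂ E := by
    have : Differentiable ℂ (fun z : Cn n => inner ℂ a z) := (innerSL ℂ a).differentiable
    exact ((this.sub_const _).const_mul _).cexp
  refine ⟨fun z => P z * E z, hP.mul hE, by simp [hPa, E], fun i hi => by simp [hPx i hi], ?_⟩
  intro z hz
  rw [norm_mul]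
  have h1 := hC z hz
  have h2 : ‖E z‖ ≤ Real.exp (-δ) ^ m := by
    rw [Complex.norm_exp, ← Real.exp_nat_mul]
    refine Real.exp_le_exp.2 ?_
    have e : ((m : ℂ) * (inner ℂ a z - inner ℂ a a)).re
        = m * ((inner ℂ a z : ℂ).re - ‖a‖ ^ 2) := by
      rw [inner_self_eq_norm_sq_to_K]
      simp [← Complex.ofReal_pow]
    rw [e]
    refine mul_le_mul_of_nonneg_left ?_ (Nat.cast_nonneg m)
    have h3 : (inner ℂ a z : ℂ).re ≤ ‖a‖ * ‖z‖ :=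
      (Complex.re_le_norm _).trans (norm_inner_le_norm a z)
    have h4 : ‖z‖ ≤ R := by simpa using hz
    have : ‖a‖ * ‖z‖ ≤ ‖a‖ * R := by gcongr
    rw [hδ]; nlinarith
  calc ‖P z‖ * ‖E z‖ ≤ (|C| + 1) * Real.exp (-δ) ^ m := by
        gcongr
        linarith [le_abs_self C]
    _ ≤ ε := hm.le

lemma exists_trap (f : Endo n) (B : Set (Cn n)) (R : ℝ) (hR : 0 ≤ R) (z : Cn n) (hz : z ∈ B)
    (N : ℕ) (hN : (eapp f)^[N] z ∉ closedBall (0 : Cn n) R)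
    (hmin : ∀ i < N, (eapp f)^[i] z ∈ closedBall (0 : Cn n) R) (ε : ℝ) (hε : 0 < ε) :
    ∃ g ∈ trapSet B, ∀ w ∈ closedBall (0 : Cn n) R, ‖eapp f w - eapp g w‖ ≤ ε := by
  set a := (eapp f)^[N] z with ha
  have hf : Differentiable ℂ (eapp f) := f.2
  have haR : R < ‖a‖ := by simpa using hN
  obtain ⟨C, hC⟩ := (isCompact_closedBall (0 : Cn n) R).exists_bound_of_continuousOn
    (f := fun w => a - eapp f w) (by have := hf.continuous; fun_prop)
  obtain ⟨χ, hχ, hχa, hχ0, hχε⟩ := exists_chi R hR a haR N (fun i => (eapp f)^[i] z)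
    (fun i hi h => hN (h ▸ hmin i hi)) (min 1 (ε / (3 * (|C| + 1)))) (by positivity)
  let G : Cn n → Cn n := fun w => eapp f w + (χ w * (2 - χ w)) • (a - eapp f w)
  have hG : Differentiable ℂ G := by
    refine hf.add (Differentiable.smul (hχ.mul (hχ.const_sub 2)) (hf.const_sub a))
  let g : Endo n := ⟨⟨G, hG.continuous⟩, hG⟩
  have hgG : eapp g = G := rfl
  refine ⟨g, ?_, ?_⟩
  · have hga : G a = a := by simp only [G, hχa]; norm_num
    have hd : HasFDerivAt G (0 : Cn n →L[ℂ] Cn n) a := by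
      have e : G = fun w => a - ((1 - χ w) * (1 - χ w)) • (a - eapp f w) := by
        funext w
        simp only [G]
        module
      rw [e]
      have h1 : HasFDerivAt (fun w => 1 - χ w) (-(fderiv ℂ χ a)) a :=
        (hχ a).hasFDerivAt.const_sub 1
      have h2 := (h1.mul h1).smul ((hf a).hasFDerivAt.const_sub a)
      have h3 := h2.const_sub a
      refine h3.congr_fderiv ?_
      refine ContinuousLinearMap.ext fun v => ?_
      simp [hχa]
    have hlo := hd.isLittleO.def (show (0 : ℝ) < 1 / 2 by norm_num)
    obtain ⟨r0, hr0, hball⟩ := Metric.mem_nhds_iff.1 hlo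
    refine ⟨z, hz, N, a, r0 / 2, ?_, ?_⟩
    · have : ∀ i ≤ N, (eapp g)^[i] z = (eapp f)^[i] z := by
        intro i
        induction i with
        | zero => intro _; rfl
        | succ i ih =>
          intro hi
          rw [Function.iterate_succ_apply', Function.iterate_succ_apply', ih (by omega), hgG]
          simp only [G]
          rw [hχ0 i (by omega)]
          simp
      rw [this N le_rfl]
      exact mem_ball_self (by positivity)
    · intro w hw
      rw [mem_closedBall, dist_eq_norm] at hw
      have hw' : w ∈ ball a r0 := by rw [mem_ball, dist_eq_norm]; linarith
      have := hball hw'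
      simp only [Set.mem_setOf_eq, hga, ContinuousLinearMap.zero_apply, sub_zero] at this
      rw [mem_ball, dist_eq_norm, hgG]
      linarith
  · intro w hw
    have h1 := hχε w hw
    have h2 : ‖χ w‖ ≤ 1 := h1.trans (min_le_left _ _)
    have h3 : ‖χ w‖ ≤ ε / (3 * (|C| + 1)) := h1.trans (min_le_right _ _)
    have h4 : ‖a - eapp f w‖ ≤ |C| + 1 := (hC w hw).trans (by linarith [le_abs_self C])
    have h5 : ‖2 - χ w‖ ≤ 3 := by
      refine (norm_sub_le _ _).trans ?_
      have : ‖(2 : ℂ)‖ = 2 := by simp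
      linarith
    have e : eapp f w - eapp g w = -((χ w * (2 - χ w)) • (a - eapp f w)) := by
      rw [hgG]; simp [G]
    rw [e, norm_neg, norm_smul, norm_mul]
    calc _ ≤ ε / (3 * (|C| + 1)) * 3 * (|C| + 1) := by gcongr
      _ = ε := by field_simp

lemma closure_trap (f : Endo n) (B : Set (Cn n))
    (h : ∀ R : ℕ, ∃ z ∈ B, ∃ N, (eapp f)^[N] z ∉ closedBall (0 : Cn n) R) :
    f ∈ closure (trapSet B) := by
  classical
  have hg : ∀ R : ℕ, ∃ g ∈ trapSet B, ∀ w ∈ closedBall (0 : Cn n) R,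
      ‖eapp f w - eapp g w‖ ≤ 1 / ((R : ℝ) + 1) := by
    intro R
    obtain ⟨z, hz, hN⟩ := h R
    exact exists_trap f B R (Nat.cast_nonneg R) z hz (Nat.find hN) (Nat.find_spec hN)
      (fun i hi => not_not.1 (Nat.find_min hN hi)) _ (by positivity)
  choose g hg1 hg2 using hg
  refine mem_closure_of_tendsto (f := g) (b := atTop) ?_ (Eventually.of_forall hg1)
  refine tendsto_endo _ _ fun K hK => ?_
  obtain ⟨M, hM⟩ := hK.isBounded.exists_norm_le
  rw [Metric.tendstoUniformlyOn_iff]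
  intro ε hε
  have hl := (tendsto_one_div_add_atTop_nhds_zero_nat (𝕜 := ℝ)).eventually (gt_mem_nhds hε)
  filter_upwards [hl, eventually_ge_atTop ⌈M⌉₊] with R h1 h2 x hx
  rw [dist_eq_norm]
  refine (hg2 R x ?_).trans_lt h1
  rw [mem_closedBall_zero_iff]
  exact (hM x hx).trans ((Nat.le_ceil M).trans (by exact_mod_cast h2))

lemma bounded_residual (B : Set (Cn n)) (hB : B.Nonempty) :
    {f : Endo n | ∃ z ∈ B, z ∈ boundedOrb f} ∈ residual (Endo n) := by
  have ho := trap_open B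
  have hres : (frontier (trapSet B))ᶜ ∈ residual (Endo n) := by
    refine residual_of_dense_open isClosed_frontier.isOpen_compl ?_
    rw [← interior_eq_empty_iff_dense_compl, ← frontier_compl]
    exact interior_frontier ho.isClosed_compl
  refine mem_of_superset hres fun f hf => ?_
  by_cases hS : ∀ R : ℕ, ∃ z ∈ B, ∃ N, (eapp f)^[N] z ∉ closedBall (0 : Cn n) R
  · have hc := closure_trap f B hS
    refine trap_bounded B f ?_
    by_contra hn
    refine hf ?_
    rw [ho.frontier_eq]
    exact ⟨hc, hn⟩
  · push Not at hS
    obtain ⟨R, hR⟩ := hS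
    obtain ⟨z, hz⟩ := hB
    exact ⟨z, hz, closedBall 0 R, isCompact_closedBall _ _, hR z hz⟩

lemma dense_residual : {f : Endo n | Dense (boundedOrb f)} ∈ residual (Endo n) := by
  have hc := TopologicalSpace.countable_countableBasis (Cn n)
  have hb := TopologicalSpace.isBasis_countableBasis (Cn n)
  have h : (⋂ B ∈ TopologicalSpace.countableBasis (Cn n),
      {f : Endo n | ∃ z ∈ B, z ∈ boundedOrb f}) ∈ residual (Endo n) :=
    (countable_bInter_mem hc).2 fun B hB => bounded_residual B
      (TopologicalSpace.nonempty_of_mem_countableBasis hB)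
  refine mem_of_superset h fun f hf => ?_
  refine hb.dense_iff.2 fun B hB _ => ?_
  obtain ⟨z, hz, hz2⟩ := Set.mem_iInter₂.1 hf B hB
  exact ⟨z, hz, hz2⟩

/-- For a generic endomorphism `f` of `ℂⁿ`, the Fatou set is forward invariant and completely
invariant, hence the Julia set is completely invariant as well. -/
theorem stmt_10 (n : ℕ) (hn : 1 ≤ n) :
    {f : Endo n | eapp f '' Fatou f ⊆ Fatou f ∧ eapp f ⁻¹' Fatou f = Fatou f ∧
      eapp f ⁻¹' Julia f = Julia f ∧ eapp f '' Julia f ⊆ Julia f} ∈ residual (Endo n) := by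
  filter_upwards [dense_residual (n := n), residual_of_dense_open jac_open jac_dense] with f h1 h2
  have hfw := fatou_forward f h2 h1
  have hbw := fatou_backward f
  refine ⟨?_, ?_, ?_, ?_⟩
  · rintro _ ⟨p, hp, rfl⟩
    exact hfw p hp
  · ext p
    exact ⟨hbw p, hfw p⟩
  · ext p
    exact not_congr ⟨hbw p, hfw p⟩
  · rintro _ ⟨p, hp, rfl⟩ h
    exact hp (hbw p h)
end
end

section
/- For a generic endomorphism f of ℂⁿ (n ≥ 1): (a) J_f equals the closure of rep(f), and if n ≥ 2 then J_f also equals the closure of sad(f); (b) for every m ≥ 2, the m-th iterate has the same Fatou and Julia sets as f: F_{f^[m]} = F_f and J_{f^[m]} = J_f. (Proposition 2.12 of the paper, proved for Oka-Stein manifolds; specialized to ℂⁿ.) -/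
open Function Topology Filter Metric

noncomputable section

variable {n : ℕ}

lemma cauchy_fderiv {u : Cn n → Cn n} {q : Cn n} {r M : ℝ} (hr : 0 < r)
    (hu : Differentiable ℂ u) (hM : ∀ z ∈ closedBall q r, ‖u z‖ ≤ M) :
    ‖fderiv ℂ u q‖ ≤ M / r := by
  have hM0 : 0 ≤ M := (norm_nonneg _).trans (hM q (mem_closedBall_self hr.le))
  refine ContinuousLinearMap.opNorm_le_bound _ (by positivity) fun v => ?_
  rcases eq_or_ne v 0 with rfl | hv
  · simp
  have hv' : 0 < ‖v‖ := norm_pos_iff.2 hv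
  have h1 : HasDerivAt (fun t : ℂ => u (q + t • v)) (fderiv ℂ u q v) 0 := by
    have hl : HasDerivAt (fun t : ℂ => q + t • v) v 0 := by
      simpa using ((hasDerivAt_id (0:ℂ)).smul_const v).const_add q
    have := (hu (q + (0:ℂ) • v)).hasFDerivAt.comp_hasDerivAt (0:ℂ) hl
    rw [zero_smul, add_zero] at this
    exact this
  have hd : Differentiable ℂ (fun t : ℂ => u (q + t • v)) :=
    hu.comp (by fun_prop)
  have h2 := Complex.norm_deriv_le_of_forall_mem_sphere_norm_le (c := (0:ℂ)) (R := r / ‖v‖) (C := M)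
    (f := fun t : ℂ => u (q + t • v)) (by positivity) hd.diffContOnCl (by
      intro z hz
      apply hM
      have hz' : ‖z‖ = r / ‖v‖ := by simpa using hz
      simp [mem_closedBall, dist_eq_norm, norm_smul, hz', hv'.ne'])
  rw [h1.deriv] at h2
  calc _ ≤ _ := h2
    _ = _ := by field_simp

lemma lip_of_bdd {u : Cn n → Cn n} {p : Cn n} {r s M : ℝ} (hr : 0 < r)
    (hu : Differentiable ℂ u) (hM : ∀ z ∈ closedBall p (s + r), ‖u z‖ ≤ M) :
    ∀ z ∈ closedBall p s, ‖fderiv ℂ u z‖ ≤ M / r := by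
  intro z hz
  refine cauchy_fderiv hr hu fun w hw => hM w ?_
  rw [mem_closedBall] at *
  linarith [dist_triangle w z p]

lemma weier {F : ℕ → Cn n → Cn n} {g : Cn n → Cn n} {p : Cn n} {r : ℝ} (hr : 0 < r)
    (hF : ∀ j, Differentiable ℂ (F j))
    (h : TendstoUniformlyOn F g atTop (closedBall p (2 * r))) :
    DifferentiableOn ℂ g (ball p r) := by
  have hc : UniformCauchySeqOn (fun j => fderiv ℂ (F j)) atTop (ball p r) := by
    rw [Metric.uniformCauchySeqOn_iff]
    intro ε hε
    obtain ⟨N, hN⟩ := Metric.uniformCauchySeqOn_iff.1 h.uniformCauchySeqOn (ε / 2 * r) (by positivity)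
    refine ⟨N, fun m hm k hk x hx => ?_⟩
    have := lip_of_bdd (u := fun z => F m z - F k z) (p := p) (s := r) (M := ε / 2 * r) hr
      ((hF m).sub (hF k)) (by
        intro z hz
        rw [← dist_eq_norm]
        exact (hN m hm k hk z (by rwa [two_mul])).le) x (ball_subset_closedBall hx)
    rw [fderiv_fun_sub (hF m x) (hF k x), ← dist_eq_norm] at this
    have h2 : ε / 2 * r / r = ε / 2 := by field_simp
    linarith
  have hlim : ∀ x : Cn n, ∃ L, x ∈ ball p r → Tendsto (fun j => fderiv ℂ (F j) x) atTop (𝓝 L) := by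
    intro x
    by_cases hx : x ∈ ball p r
    · obtain ⟨L, hL⟩ := cauchySeq_tendsto_of_complete (hc.cauchySeq hx)
      exact ⟨L, fun _ => hL⟩
    · exact ⟨0, fun h => absurd h hx⟩
  choose g' hg' using hlim
  have hu := hc.tendstoUniformlyOn_of_tendsto (fun x hx => hg' x hx)
  intro x hx
  have hsub : ball p r ⊆ closedBall p (2 * r) :=
    (ball_subset_ball (by linarith)).trans ball_subset_closedBall
  exact (hasFDerivAt_of_tendstoUniformlyOn isOpen_ball hu
    (fun j x _ => (hF j x).hasFDerivAt) (fun x hx => h.tendsto_at (hsub hx)) hx).differentiableAt.differentiableWithinAt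

lemma montel {F : ℕ → Cn n → Cn n} {p : Cn n} {r M : ℝ} (hr : 0 < r)
    (hF : ∀ j, Differentiable ℂ (F j))
    (hM : ∀ j, ∀ z ∈ closedBall p (2 * r + r), ‖F j z‖ ≤ M) :
    ∃ l : ℕ → ℕ, StrictMono l ∧ ∃ g : Cn n → Cn n, DifferentiableOn ℂ g (ball p r) ∧
      TendstoLocallyUniformlyOn (fun j => F (l j)) g atTop (ball p r) := by
  have hM0 : 0 ≤ M := (norm_nonneg _).trans (hM 0 p (mem_closedBall_self (by positivity)))
  have hlip : ∀ j, LipschitzOnWith (M / r).toNNReal (F j) (closedBall p (2 * r)) := by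
    intro j
    refine (convex_closedBall p (2 * r)).lipschitzOnWith_of_nnnorm_fderiv_le (𝕜 := ℂ)
      (fun x _ => hF j x) fun x hx => ?_
    have := lip_of_bdd hr (hF j) (hM j) x hx
    rw [← NNReal.coe_le_coe, Real.coe_toNNReal _ (by positivity)]
    exact this
  have : CompactSpace (closedBall p (2 * r)) := isCompact_iff_compactSpace.1 (isCompact_closedBall _ _)
  let Φ : ℕ → BoundedContinuousFunction (closedBall p (2 * r)) (Cn n) := fun j =>
    BoundedContinuousFunction.mkOfCompact ⟨fun z => F j z, (hF j).continuous.comp continuous_subtype_val⟩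
  have hcomp := BoundedContinuousFunction.arzela_ascoli (closedBall (0 : Cn n) M) (isCompact_closedBall _ _)
    (Set.range Φ) (by
      rintro f x ⟨j, rfl⟩
      simpa [Φ] using hM j x (closedBall_subset_closedBall (by linarith) x.2)) (by
      apply LipschitzWith.uniformEquicontinuous (K := (M / r).toNNReal) _ _ |>.equicontinuous
      rintro ⟨_, ⟨j, rfl⟩⟩
      exact (lipschitzOnWith_iff_restrict.1 (hlip j)))
  obtain ⟨G, -, l, hl, hlG⟩ := hcomp.tendsto_subseq (fun j => subset_closure (Set.mem_range_self (f := Φ) j))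
  classical
  let g : Cn n → Cn n := fun z => if h : z ∈ closedBall p (2 * r) then G ⟨z, h⟩ else 0
  have hu : TendstoUniformlyOn (fun j => F (l j)) g atTop (closedBall p (2 * r)) := by
    rw [BoundedContinuousFunction.tendsto_iff_tendstoUniformly] at hlG
    rw [Metric.tendstoUniformlyOn_iff]
    intro ε hε
    filter_upwards [Metric.tendstoUniformly_iff.1 hlG ε hε] with j hj x hx
    have := hj ⟨x, hx⟩
    simp only [g, dif_pos hx]
    exact this
  refine ⟨l, hl, g, weier hr (fun j => hF _) hu, ?_⟩
  exact (hu.mono ((ball_subset_ball (by linarith)).trans ball_subset_closedBall)).tendstoLocallyUniformlyOn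

lemma eapp_diff (f : Endo n) : Differentiable ℂ (eapp f) := f.2

lemma iter_diff (f : Endo n) (m : ℕ) : Differentiable ℂ ((eapp f)^[m]) := f.2.iterate m

lemma rne_sub_fatou (f : Endo n) : rne f ⊆ Fatou f := by
  rintro p ⟨U, hU, hp, V, hV, K, hK, h⟩
  obtain ⟨R, hR, hRU⟩ := Metric.isOpen_iff.1 hU p hp
  obtain ⟨M, hM⟩ := hK.isBounded.exists_norm_le
  refine ⟨ball p (R / 4), isOpen_ball, mem_ball_self (by positivity), fun k hk => ?_⟩
  obtain ⟨l, hl, g, hg, hlg⟩ := montel (F := fun j => (eapp f)^[k j]) (p := p) (r := R / 4) (M := M)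
    (by positivity) (fun j => iter_diff f _) (fun j z hz => hM _ (h f (mem_of_mem_nhds hV) (k j)
      ⟨z, hRU (by rw [mem_closedBall] at hz; rw [mem_ball]; linarith), rfl⟩))
  exact ⟨l, hl, Or.inl ⟨g, hg, hlg⟩⟩

lemma julia_closed (f : Endo n) : IsClosed (Julia f) := by
  rw [Julia, isClosed_compl_iff, isOpen_iff_mem_nhds]
  rintro p ⟨U, hU, hp, h⟩
  exact mem_of_superset (hU.mem_nhds hp) fun q hq => ⟨U, hU, hq, h⟩

lemma iter_iter (f : Endo n) (m j : ℕ) : (eapp (iterEndo f m))^[j] = (eapp f)^[m * j] := by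
  rw [Function.iterate_mul]; rfl

lemma fatou_sub_iter (f : Endo n) {m : ℕ} (hm : 1 ≤ m) : Fatou f ⊆ Fatou (iterEndo f m) := by
  rintro p ⟨U, hU, hp, h⟩
  refine ⟨U, hU, hp, fun k hk => ?_⟩
  obtain ⟨l, hl, h⟩ := h (fun j => m * k j) (fun a b hab => Nat.mul_lt_mul_of_pos_left (hk hab) hm)
  refine ⟨l, hl, ?_⟩
  simpa only [iter_iter] using h

lemma hasFDerivAt_iter_pow {F : Cn n → Cn n} {A : Cn n →L[ℂ] Cn n} {p : Cn n} (hF : HasFDerivAt F A p)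
    (hp : F p = p) (j : ℕ) : HasFDerivAt (F^[j]) (A ^ j) p := hF.iterate hp j

lemma exists_eigvec {A : Cn n →L[ℂ] Cn n} {μ : ℂ} (h : μ ∈ spectrum ℂ A) : ∃ v, v ≠ 0 ∧ A v = μ • v := by
  have h2 : μ ∈ spectrum ℂ (A : Cn n →ₗ[ℂ] Cn n) := by
    rw [← AlgEquiv.spectrum_eq (Module.End.toContinuousLinearMap (𝕜 := ℂ) (Cn n))]
    exact h
  obtain ⟨v, hv⟩ := (Module.End.hasEigenvalue_iff_mem_spectrum.2 h2).exists_hasEigenvector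
  exact ⟨v, hv.2, hv.apply_eq_smul⟩

lemma pow_le_opNorm {A : Cn n →L[ℂ] Cn n} {v : Cn n} (hv : v ≠ 0) {μ : ℂ} (hA : A v = μ • v) (k : ℕ) :
    ‖μ‖ ^ k ≤ ‖A ^ k‖ := by
  have hpow : (A ^ k) v = μ ^ k • v := by
    induction k with
    | zero => simp
    | succ k ih => rw [pow_succ, mul_apply_eq_comp, hA, map_smul, ih, smul_smul, pow_succ, mul_comm]
  have h3 := (A ^ k).le_opNorm v
  rw [hpow, norm_smul, norm_pow] at h3
  exact le_of_mul_le_mul_right h3 (norm_pos_iff.2 hv)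

lemma fderiv_iter_mul {f : Endo n} {p : Cn n} {m : ℕ} (hp : (eapp f)^[m] p = p) (k : ℕ) :
    fderiv ℂ ((eapp f)^[m * k]) p = (fderiv ℂ ((eapp f)^[m]) p) ^ k := by
  have hd : HasFDerivAt (((eapp f)^[m])^[k]) ((fderiv ℂ ((eapp f)^[m]) p) ^ k) p :=
    hasFDerivAt_iter_pow (iter_diff f m p).hasFDerivAt hp _
  rw [Function.iterate_mul]
  exact hd.fderiv

lemma bdd_of_tendsto {F : ℕ → Cn n → Cn n} {g : Cn n → Cn n} {U : Set (Cn n)} (hU : IsOpen U)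
    {p : Cn n} (hpU : p ∈ U) (hg : DifferentiableOn ℂ g U) (hlg : TendstoLocallyUniformlyOn F g atTop U) :
    ∃ r : ℝ, 0 < r ∧ ∃ M : ℝ, ∀ᶠ j in atTop, ∀ z ∈ closedBall p r, ‖F j z‖ ≤ M := by
  have hcont : ContinuousAt g p := (hg.differentiableAt (hU.mem_nhds hpU)).continuousAt
  obtain ⟨t, ht, htl⟩ := Metric.tendstoLocallyUniformlyOn_iff.1 hlg 1 one_pos p hpU
  rw [hU.nhdsWithin_eq hpU] at ht
  have h1 : ∀ᶠ z in 𝓝 p, dist (g z) (g p) < 1 := Metric.tendsto_nhds.1 hcont 1 one_pos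
  obtain ⟨r, hr, hrs⟩ := Metric.nhds_basis_closedBall.mem_iff.1 (inter_mem ht h1)
  refine ⟨r, hr, ‖g p‖ + 2, ?_⟩
  filter_upwards [htl] with j hj z hz
  have a1 := hj z (hrs hz).1
  have a2 : dist (g z) (g p) < 1 := (hrs hz).2
  have a3 := dist_triangle (F j z) (g z) (g p)
  rw [dist_comm _ (g z)] at a3
  have a4 := norm_le_norm_add_norm_sub' (F j z) (g p)
  rw [← dist_eq_norm] at a4
  linarith

lemma expand_julia {f : Endo n} {p : Cn n} {m : ℕ} (hm : 1 ≤ m) (hp : (eapp f)^[m] p = p)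
    {v : Cn n} (hv : v ≠ 0) {μ : ℂ} (hμ : 1 < ‖μ‖) (hA : fderiv ℂ ((eapp f)^[m]) p v = μ • v) :
    p ∈ Julia f := by
  rintro ⟨U, hU, hpU, h⟩
  obtain ⟨l, hl, h⟩ := h (fun j => m * j) (fun a b hab => Nat.mul_lt_mul_of_pos_left hab hm)
  rcases h with ⟨g, hg, hlg⟩ | h
  · obtain ⟨r, hr, M, hM⟩ := bdd_of_tendsto hU hpU hg hlg
    have hbd : ∀ᶠ j in atTop, ‖μ‖ ^ (l j) ≤ M / r := by
      filter_upwards [hM] with j hj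
      have hc := cauchy_fderiv hr (iter_diff f _) hj
      rw [fderiv_iter_mul hp] at hc
      exact (pow_le_opNorm hv hA _).trans hc
    have ht : Tendsto (fun j => ‖μ‖ ^ (l j)) atTop atTop :=
      (tendsto_pow_atTop_atTop_of_one_lt hμ).comp hl.tendsto_atTop
    obtain ⟨j, h1, h2⟩ := (hbd.and (ht.eventually_gt_atTop (M / r))).exists
    linarith
  · obtain ⟨j, hj⟩ := (h {p} (by simpa using hpU) isCompact_singleton {p} isCompact_singleton).exists
    have hfix : (eapp f)^[m * l j] p = p := by
      rw [Function.iterate_mul]; exact Function.iterate_fixed hp _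
    rw [Set.image_singleton, Set.disjoint_singleton] at hj
    exact hj hfix

lemma nhd1 (f : Endo n) {V : Set (Endo n)} (hV : V ∈ 𝓝 f) :
    ∃ R : ℝ, 0 < R ∧ ∃ ε : ℝ, 0 < ε ∧ ∀ g : Endo n,
      (∀ z ∈ closedBall (0 : Cn n) R, dist (eapp f z) (eapp g z) < ε) → g ∈ V := by
  rw [nhds_induced, mem_comap] at hV
  obtain ⟨W, hW, hWV⟩ := hV
  have hb := nhds_basis_uniformity' (x := f.1)
    (Metric.uniformity_basis_dist.compactConvergenceUniformity (α := Cn n) (β := Cn n))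
  obtain ⟨⟨K, ε⟩, ⟨hK, hε⟩, h⟩ := hb.mem_iff.1 hW
  obtain ⟨R, hR, hKR⟩ := hK.isBounded.subset_closedBall_lt 0 0
  exact ⟨R, hR, ε, hε, fun g hg => hWV (h fun z hz => hg z (hKR hz))⟩

lemma nhd2 (f : Endo n) {K : Set (Cn n)} (hK : IsCompact K) {ε : ℝ} (hε : 0 < ε) :
    ∀ᶠ g in 𝓝 f, ∀ z ∈ K, dist (eapp f z) (eapp g z) < ε := by
  have h : Tendsto (fun g : Endo n => g.1) (𝓝 f) (𝓝 f.1) := continuous_subtype_val.continuousAt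
  rw [ContinuousMap.tendsto_iff_forall_isCompact_tendstoUniformlyOn] at h
  exact Metric.tendstoUniformlyOn_iff.1 (h K hK) ε hε

lemma iterEndo_cont (m : ℕ) : Continuous (fun f : Endo n => iterEndo f m) := by
  refine Continuous.subtype_mk (f := fun f : Endo n => (⟨(eapp f)^[m], f.1.continuous.iterate m⟩ : C(Cn n, Cn n))) ?_ _
  induction m with
  | zero =>
    have : (fun f : Endo n => (⟨(eapp f)^[0], f.1.continuous.iterate 0⟩ : C(Cn n, Cn n)))
      = fun _ => ContinuousMap.id _ := by ext; rfl
    rw [this]; exact continuous_const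
  | succ m ih =>
    exact ContinuousMap.continuous_comp'.comp (continuous_subtype_val.prodMk ih)

lemma persist (hn : 1 ≤ n) (F : Endo n) {q : Cn n} (hq : eapp F q = q) {T : Cn n →L[ℂ] Cn n}
    (hT : HasFDerivAt (eapp F) T q) (hunit : IsUnit (T - 1)) {S : Set (Cn n →L[ℂ] Cn n)} (hS : S ∈ 𝓝 T)
    {B : Set (Cn n)} (hB : B ∈ 𝓝 q) :
    ∀ᶠ G in 𝓝 F, ∃ q' ∈ B, eapp G q' = q' ∧ fderiv ℂ (eapp G) q' ∈ S := by
  obtain ⟨e, he⟩ : ∃ e : Cn n ≃L[ℂ] Cn n, (e : Cn n →L[ℂ] Cn n) = T - 1 :=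
    ⟨ContinuousLinearEquiv.unitsEquiv ℂ (Cn n) hunit.unit, by ext; rfl⟩
  let N : ℝ := e.toNonlinearRightInverse.nnnorm
  have hN : 0 ≤ N := NNReal.coe_nonneg _
  obtain ⟨δ, hδ, hδS⟩ := Metric.mem_nhds_iff.1 hS
  -- choose ε
  obtain ⟨ε, hε, hεδ, hεN⟩ : ∃ ε : ℝ, 0 < ε ∧ 3 * ε < δ ∧ ε * (4 * (N + 1)) ≤ 1 := by
    refine ⟨min (δ / 4) (1 / (4 * (N + 1))), by positivity, ?_, ?_⟩
    · linarith [min_le_left (δ / 4) (1 / (4 * (N + 1)))]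
    · calc _ ≤ (1 / (4 * (N + 1))) * (4 * (N + 1)) := by gcongr; exact min_le_right _ _
        _ = 1 := by field_simp
  have h1 := (hasFDerivAt_iff_isLittleO.1 hT).def hε
  obtain ⟨ρ, hρ, hρs⟩ := Metric.nhds_basis_closedBall.mem_iff.1 (inter_mem h1 hB)
  obtain ⟨r, hr, rfl⟩ : ∃ r, 0 < r ∧ ρ = r + r := ⟨ρ / 2, by positivity, by ring⟩
  filter_upwards [nhd2 F (isCompact_closedBall q (r + r)) (show 0 < ε * r by positivity)] with G hG
  have hGd : Differentiable ℂ (fun z => eapp G z - q - T (z - q)) := by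
    have := eapp_diff G
    fun_prop
  have hb : ∀ z ∈ closedBall q (r + r), ‖eapp G z - q - T (z - q)‖ ≤ 3 * ε * r := by
    intro z hz
    have a1 : ‖eapp F z - eapp F q - T (z - q)‖ ≤ ε * ‖z - q‖ := (hρs hz).1
    have a2 := hG z hz
    rw [hq] at a1
    have a3 : ‖z - q‖ ≤ r + r := by rw [← dist_eq_norm]; exact hz
    have a4 : eapp G z - q - T (z - q) = (eapp F z - q - T (z - q)) - (eapp F z - eapp G z) := by abel
    rw [a4]
    rw [dist_eq_norm] at a2
    calc _ ≤ _ := norm_sub_le _ _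
      _ ≤ ε * (r + r) + ε * r := by
        gcongr
        exact a1.trans (by gcongr)
      _ = _ := by ring
  have hder : ∀ z ∈ closedBall q r, ‖fderiv ℂ (eapp G) z - T‖ ≤ 3 * ε := by
    intro z hz
    have := lip_of_bdd hr hGd hb z hz
    have e1 : HasFDerivAt (fun z => eapp G z - q - T (z - q)) (fderiv ℂ (eapp G) z - T) z := by
      have := ((eapp_diff G z).hasFDerivAt.sub_const q).sub (T.hasFDerivAt.comp z ((hasFDerivAt_id z).sub_const q))
      exact this
    rw [e1.fderiv] at this
    calc _ ≤ _ := this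
      _ = _ := by field_simp
  have happ : ApproximatesLinearOn (fun z => eapp G z - z) (e : Cn n →L[ℂ] Cn n) (closedBall q r)
      (3 * ε).toNNReal := by
    intro x hx y hy
    have := (convex_closedBall q r).norm_image_sub_le_of_norm_hasFDerivWithin_le
      (f := fun z => eapp G z - T z) (f' := fun z => fderiv ℂ (eapp G) z - T) (C := 3 * ε)
      (fun z _ => ((eapp_diff G z).hasFDerivAt.sub T.hasFDerivAt).hasFDerivWithinAt) hder hy hx
    rw [Real.coe_toNNReal _ (by positivity)]
    convert this using 2
    rw [he]
    simp only [sub_apply, one_apply_eq_self, map_sub]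
    abel
  have hsurj := happ.surjOn_closedBall_of_nonlinearRightInverse e.toNonlinearRightInverse hr.le subset_rfl
  have h0 : (0 : Cn n) ∈ closedBall (eapp G q - q)
      (((e.toNonlinearRightInverse.nnnorm : ℝ)⁻¹ - (3 * ε).toNNReal) * r) := by
    have a2 := hG q (mem_closedBall_self (by positivity))
    rw [hq, dist_eq_norm] at a2
    rw [mem_closedBall, dist_eq_norm, zero_sub, neg_sub, Real.coe_toNNReal _ (by positivity)]
    refine a2.le.trans ?_
    gcongr
    change ε ≤ N⁻¹ - 3 * ε
    rcases hN.eq_or_lt with hN0 | hN0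
    · exfalso
      have : Nonempty (Fin n) := ⟨⟨0, hn⟩⟩
      have : Nontrivial (Cn n) := (WithLp.equiv 2 (Fin n → ℂ)).nontrivial
      exact absurd hN0 e.norm_symm_pos.ne
    · have : 4 * ε ≤ N⁻¹ := by
        rw [← one_div, le_div_iff₀ hN0]
        nlinarith
      linarith
  obtain ⟨q', hq', hq'0⟩ := hsurj h0
  refine ⟨q', (hρs (closedBall_subset_closedBall (by linarith) hq')).2, sub_eq_zero.1 hq'0, hδS ?_⟩
  rw [mem_ball, dist_eq_norm]
  exact (hder q' hq').trans_lt hεδ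

lemma exists_sep (S : Finset (Cn n)) {a : Cn n} (ha : a ∉ S) :
    ∃ P : Cn n → ℂ, Differentiable ℂ P ∧ P a = 1 ∧ ∀ x ∈ S, P x = 0 := by
  refine ⟨fun z => ∏ x ∈ S, (innerSL ℂ (a - x)) (z - x) / (innerSL ℂ (a - x)) (a - x), ?_, ?_, ?_⟩
  · intro z
    refine (HasFDerivAt.finsetProd (u := S) (x := z) (g := fun (x : Cn n) z => (innerSL ℂ (a - x)) (z - x) / (innerSL ℂ (a - x)) (a - x)) (g' := fun x => fderiv ℂ (fun z => (innerSL ℂ (a - x)) (z - x) / (innerSL ℂ (a - x)) (a - x)) z) fun x _ => ?_).differentiableAt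
    apply DifferentiableAt.hasFDerivAt
    fun_prop
  · apply Finset.prod_eq_one
    intro x hx
    apply div_self
    rw [innerSL_apply_apply, inner_self_ne_zero, sub_ne_zero]
    rintro rfl; exact ha hx
  · intro x hx
    apply Finset.prod_eq_zero hx
    simp

lemma step_lemma {P : Cn n → ℂ} (hP : Differentiable ℂ P) {x : Cn n} (hx : P x = 0 ∨ P x = 1) :
    HasFDerivAt (fun z => P z ^ 2 * (3 - 2 * P z)) (0 : Cn n →L[ℂ] ℂ) x := by
  have h : HasDerivAt (fun t : ℂ => t ^ 2 * (3 - 2 * t)) 0 (P x) := by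
    have := ((hasDerivAt_id (P x)).pow 2).mul (((hasDerivAt_id (P x)).const_mul 2).const_sub 3)
    refine this.congr_deriv ?_
    simp only [id, Nat.cast_ofNat]
    rcases hx with hx | hx <;> rw [hx] <;> norm_num
  have := h.comp_hasFDerivAt x (hP x).hasFDerivAt
  have e : (0 : ℂ) • fderiv ℂ P x = 0 := by ext v; simp
  exact this.congr_fderiv e

lemma bump (S : Finset (Cn n)) {a : Cn n} (ha : a ∉ S) :
    ∃ P : Cn n → ℂ, Differentiable ℂ P ∧ P a = 1 ∧ HasFDerivAt P (0 : Cn n →L[ℂ] ℂ) a ∧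
      ∀ x ∈ S, P x = 0 ∧ HasFDerivAt P (0 : Cn n →L[ℂ] ℂ) x := by
  obtain ⟨P, hP, h1, h0⟩ := exists_sep S ha
  refine ⟨fun z => P z ^ 2 * (3 - 2 * P z), by fun_prop, by simp [h1]; norm_num,
    step_lemma hP (Or.inr h1), fun x hx => ⟨by simp [h0 x hx], step_lemma hP (Or.inl (h0 x hx))⟩⟩

lemma bump_small (S : Finset (Cn n)) {a : Cn n} (ha : a ∉ S) {R : ℝ} (hR : 0 < R)
    (haR : a ∉ closedBall (0 : Cn n) R) {ε : ℝ} (hε : 0 < ε) :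
    ∃ P : Cn n → ℂ, Differentiable ℂ P ∧ P a = 1 ∧ HasFDerivAt P (0 : Cn n →L[ℂ] ℂ) a ∧
      (∀ x ∈ S, P x = 0 ∧ HasFDerivAt P (0 : Cn n →L[ℂ] ℂ) x) ∧ ∀ z ∈ closedBall (0 : Cn n) R, ‖P z‖ ≤ ε := by
  obtain ⟨P, hP, h1, h0⟩ := exists_sep S ha
  have haR' : R < ‖a‖ := by simpa using haR
  have ha0 : a ≠ 0 := by rintro rfl; simp at haR'; linarith
  have han : 0 < ‖a‖ := hR.trans haR'
  let l : Cn n → ℂ := fun z => (innerSL ℂ a) z / (innerSL ℂ a) a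
  have hl : Differentiable ℂ l := by fun_prop
  have hl1 : l a = 1 := div_self (by rw [innerSL_apply_apply, inner_self_ne_zero]; exact ha0)
  have hlb : ∀ z ∈ closedBall (0 : Cn n) R, ‖l z‖ ≤ R / ‖a‖ := by
    intro z hz
    have hz' : ‖z‖ ≤ R := by simpa using hz
    simp only [l, innerSL_apply_apply, norm_div]
    rw [div_le_div_iff₀ (by rw [norm_pos_iff, inner_self_ne_zero]; exact ha0) han]
    have e : ‖inner ℂ a a‖ = ‖a‖ * ‖a‖ := by
      rw [inner_self_eq_norm_sq_to_K]; simp [sq]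
    rw [e]
    calc _ ≤ (‖a‖ * ‖z‖) * ‖a‖ := by gcongr; exact norm_inner_le_norm _ _
      _ ≤ (‖a‖ * R) * ‖a‖ := by gcongr
      _ = _ := by ring
  obtain ⟨M, hM⟩ := (isCompact_closedBall (0 : Cn n) R).exists_bound_of_continuousOn hP.continuous.continuousOn
  have hM0 : 0 ≤ M := (norm_nonneg _).trans (hM 0 (by simp [hR.le]))
  have hlim : Tendsto (fun N : ℕ => (R / ‖a‖) ^ N * M) atTop (𝓝 0) := by
    simpa using (tendsto_pow_atTop_nhds_zero_of_lt_one (by positivity) ((div_lt_one han).2 haR')).mul_const M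
  have hlim2 : Tendsto (fun N : ℕ => ((R / ‖a‖) ^ N * M) ^ 2 * (3 + 2 * ((R / ‖a‖) ^ N * M))) atTop (𝓝 0) := by
    simpa using (hlim.pow 2).mul ((hlim.const_mul 2).const_add 3)
  obtain ⟨N, hN, hN0⟩ := ((hlim2.eventually_le_const hε).and (eventually_gt_atTop 0)).exists
  have hPN : Differentiable ℂ (fun z => l z ^ N * P z) := by fun_prop
  refine ⟨fun z => (l z ^ N * P z) ^ 2 * (3 - 2 * (l z ^ N * P z)), by fun_prop, by simp [h1, hl1]; norm_num,
    step_lemma hPN (Or.inr (by simp [h1, hl1])), fun x hx => ⟨by simp [h0 x hx],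
      step_lemma hPN (Or.inl (by simp [h0 x hx]))⟩, fun z hz => ?_⟩
  have hb : ‖l z ^ N * P z‖ ≤ (R / ‖a‖) ^ N * M := by
    rw [norm_mul, norm_pow]
    gcongr
    · exact hlb z hz
    · exact hM z hz
  refine le_trans ?_ hN
  rw [norm_mul, norm_pow]
  gcongr
  refine (norm_sub_le _ _).trans ?_
  rw [norm_mul]
  simp only [Complex.norm_ofNat]
  gcongr

/-- adding a correction at `a` -/
lemma corr {g : Cn n → Cn n} (hg : Differentiable ℂ g) {P : Cn n → ℂ} (hP : Differentiable ℂ P)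
    (a c : Cn n) (L : Cn n →L[ℂ] Cn n) :
    Differentiable ℂ (fun z => g z + P z • (c + L (z - a))) ∧
    (P a = 1 → HasFDerivAt P (0 : Cn n →L[ℂ] ℂ) a → HasFDerivAt (fun z => g z + P z • (c + L (z - a))) (fderiv ℂ g a + L) a) ∧
    (∀ x, P x = 0 → HasFDerivAt P (0 : Cn n →L[ℂ] ℂ) x →
      HasFDerivAt (fun z => g z + P z • (c + L (z - a))) (fderiv ℂ g x) x) := by
  have hL : ∀ x, HasFDerivAt (fun z => c + L (z - a)) L x := fun x =>
    (L.hasFDerivAt.comp x ((hasFDerivAt_id x).sub_const a)).const_add c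
  refine ⟨by fun_prop, fun h1 h2 => ?_, fun x h1 h2 => ?_⟩
  · have := (hg a).hasFDerivAt.add (h2.smul (hL a))
    refine this.congr_fderiv ?_
    ext v
    simp [h1]
  · have := (hg x).hasFDerivAt.add (h2.smul (hL x))
    refine this.congr_fderiv ?_
    ext v
    simp [h1]

lemma hermite (S : Finset (Cn n)) : ∃ R : Cn n → Cn n, Differentiable ℂ R ∧
    ∀ x ∈ S, R x = 0 ∧ HasFDerivAt R (1 : Cn n →L[ℂ] Cn n) x := by
  classical
  induction S using Finset.induction_on with
  | empty => exact ⟨0, differentiable_const 0, by simp⟩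
  | insert a S ha ih =>
    obtain ⟨R, hR, h⟩ := ih
    obtain ⟨P, hP, h1, h2, h3⟩ := bump S ha
    obtain ⟨c1, c2, c3⟩ := corr hR hP a (-R a) (1 - fderiv ℂ R a)
    refine ⟨_, c1, fun x hx => ?_⟩
    rcases Finset.mem_insert.1 hx with rfl | hx
    · refine ⟨by simp [h1], ?_⟩
      simpa using c2 h1 h2
    · refine ⟨by simp [h3 x hx, h x hx], ?_⟩
      have := c3 x (h3 x hx).1 (h3 x hx).2
      rwa [(h x hx).2.fderiv] at this

lemma cspec_finite (A : Cn n →L[ℂ] Cn n) : (spectrum ℂ A).Finite := by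
  have h := AlgEquiv.spectrum_eq (Module.End.toContinuousLinearMap (𝕜 := ℂ) (Cn n)) (A : Cn n →ₗ[ℂ] Cn n)
  have h2 : spectrum ℂ A = spectrum ℂ (A : Cn n →ₗ[ℂ] Cn n) := h
  rw [h2]
  exact Module.End.finite_spectrum _

lemma chain_iter {u w : Cn n → Cn n} (hw : Differentiable ℂ w) {q : Cn n} {j : ℕ}
    (h : ∀ i < j, u (w^[i] q) = w (w^[i] q) ∧ HasFDerivAt u (fderiv ℂ w (w^[i] q)) (w^[i] q)) :
    ∀ i ≤ j, u^[i] q = w^[i] q ∧ HasFDerivAt (u^[i]) (fderiv ℂ (w^[i]) q) q := by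
  intro i
  induction i with
  | zero =>
    intro _
    refine ⟨rfl, ?_⟩
    simpa using (hw.iterate 0 q).hasFDerivAt
  | succ i ih =>
    intro hi
    obtain ⟨h1, h2⟩ := ih (by omega)
    obtain ⟨h3, h4⟩ := h i (by omega)
    rw [Function.iterate_succ', Function.iterate_succ', Function.comp_apply, Function.comp_apply, h1]
    refine ⟨h3, ?_⟩
    have e : fderiv ℂ (w ∘ w^[i]) q = (fderiv ℂ w (w^[i] q)).comp (fderiv ℂ (w^[i]) q) :=
      fderiv_comp q (hw _) (hw.iterate i q)
    rw [e]
    rw [← h1] at h4 ⊢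
    exact h4.comp q h2

lemma isUnit_iter {w : Cn n → Cn n} (hw : Differentiable ℂ w) {q : Cn n} {j : ℕ}
    (h : ∀ i < j, IsUnit (fderiv ℂ w (w^[i] q))) :
    ∀ i ≤ j, IsUnit (fderiv ℂ (w^[i]) q) := by
  intro i
  induction i with
  | zero =>
    intro _
    have : fderiv ℂ (w^[0]) q = 1 := fderiv_id
    rw [this]
    exact isUnit_one
  | succ i ih =>
    intro hi
    rw [Function.iterate_succ']
    have e : fderiv ℂ (w ∘ w^[i]) q = (fderiv ℂ w (w^[i] q)) * (fderiv ℂ (w^[i]) q) :=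
      fderiv_comp q (hw _) (hw.iterate i q)
    rw [e]
    exact (h i (by omega)).mul (ih (by omega))

lemma exists_delta (g : Cn n → Cn n) (S : Finset (Cn n)) {η : ℝ} (hη : 0 < η) :
    ∃ δ : ℂ, ‖δ‖ < η ∧ ∀ x ∈ S, IsUnit (fderiv ℂ g x + δ • 1) := by
  have hfin : (⋃ x ∈ S, spectrum ℂ (-fderiv ℂ g x)).Finite :=
    S.finite_toSet.biUnion fun x _ => cspec_finite _
  have hinf : (ball (0 : ℂ) η).Infinite :=
    infinite_of_mem_nhds (0 : ℂ) (ball_mem_nhds _ hη)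
  obtain ⟨δ, h1, h2⟩ := (hinf.sdiff hfin).nonempty
  refine ⟨δ, by simpa using h1, fun x hx => ?_⟩
  by_contra hu
  apply h2
  simp only [Set.mem_iUnion]
  refine ⟨x, hx, ?_⟩
  rw [spectrum.mem_iff, Algebra.algebraMap_eq_smul_one, sub_neg_eq_add, add_comm]
  exact hu

lemma pert_inv {g : Cn n → Cn n} (hg : Differentiable ℂ g) (S : Finset (Cn n)) (R : ℝ) {ε : ℝ} (hε : 0 < ε) :
    ∃ g1 : Cn n → Cn n, Differentiable ℂ g1 ∧ (∀ x ∈ S, g1 x = g x ∧ IsUnit (fderiv ℂ g1 x)) ∧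
      ∀ z ∈ closedBall (0 : Cn n) R, dist (g z) (g1 z) < ε := by
  obtain ⟨Q, hQ, hQS⟩ := hermite S
  obtain ⟨M, hM⟩ := (isCompact_closedBall (0 : Cn n) R).exists_bound_of_continuousOn hQ.continuous.continuousOn
  obtain ⟨δ, hδ, hδS⟩ := exists_delta g S (η := ε / (|M| + 1)) (by positivity)
  refine ⟨fun z => g z + δ • Q z, by fun_prop, fun x hx => ⟨by simp [hQS x hx], ?_⟩, fun z hz => ?_⟩
  · have : HasFDerivAt (fun z => g z + δ • Q z) (fderiv ℂ g x + δ • (1 : Cn n →L[ℂ] Cn n)) x :=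
      (hg x).hasFDerivAt.add ((hQS x hx).2.const_smul δ)
    rw [this.fderiv]
    exact hδS x hx
  · rw [dist_self_add_right, norm_smul]
    have : ‖Q z‖ ≤ |M| := (hM z hz).trans (le_abs_self _)
    calc _ ≤ ‖δ‖ * (|M| + 1) := by gcongr; linarith
      _ < ε / (|M| + 1) * (|M| + 1) := by gcongr
      _ = ε := by field_simp

lemma close_up (f : Endo n) {p : Cn n} (hp : p ∉ rne f) {B : Set (Cn n)} (hB : IsOpen B) (hpB : p ∈ B)
    {V : Set (Endo n)} (hV : V ∈ 𝓝 f) (T : Cn n →L[ℂ] Cn n) :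
    ∃ h ∈ V, ∃ q ∈ B, ∃ m, 1 ≤ m ∧ (eapp h)^[m] q = q ∧ HasFDerivAt ((eapp h)^[m]) T q := by
  obtain ⟨R, hR, ε, hε, hRV⟩ := nhd1 f hV
  have h3 : 0 < ε / 3 := by positivity
  obtain ⟨g, hg, q, hqB, hex⟩ : ∃ g : Endo n, (∀ z ∈ closedBall (0 : Cn n) R, dist (eapp f z) (eapp g z) < ε / 3) ∧
      ∃ q ∈ B, ∃ j, (eapp g)^[j] q ∉ closedBall (0 : Cn n) R := by
    by_contra hcon
    push Not at hcon
    refine hp ⟨B, hB, hpB, _, nhd2 f (isCompact_closedBall 0 R) h3, closedBall 0 R,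
      isCompact_closedBall 0 R, fun g hg j => ?_⟩
    rintro _ ⟨z, hz, rfl⟩
    exact hcon g hg z hz j
  classical
  let j := Nat.find hex
  have hj : (eapp g)^[j] q ∉ closedBall (0 : Cn n) R := Nat.find_spec hex
  have hlt : ∀ i < j, (eapp g)^[i] q ∈ closedBall (0 : Cn n) R := fun i hi => not_not.1 (Nat.find_min hex hi)
  clear_value j
  let S : Finset (Cn n) := (Finset.range j).image fun i => (eapp g)^[i] q
  have hxS : ∀ i < j, (eapp g)^[i] q ∈ S := fun i hi => Finset.mem_image_of_mem _ (Finset.mem_range.2 hi)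
  have haS : (eapp g)^[j] q ∉ S := by
    intro h
    obtain ⟨i, hi, hie⟩ := Finset.mem_image.1 h
    exact hj (hie ▸ hlt i (Finset.mem_range.1 hi))
  clear_value S
  obtain ⟨g1, hg1, hg1S, hg1R⟩ := pert_inv (eapp_diff g) S R h3
  have hit : ∀ i ≤ j, g1^[i] q = (eapp g)^[i] q := by
    intro i
    induction i with
    | zero => intro _; rfl
    | succ i ih =>
      intro hi
      rw [Function.iterate_succ_apply', Function.iterate_succ_apply', ih (by omega)]
      exact (hg1S _ (hxS i (by omega))).1
  have hxS' : ∀ i < j, g1^[i] q ∈ S := fun i hi => by rw [hit i hi.le]; exact hxS i hi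
  rw [← hit j le_rfl] at haS hj
  clear hxS hlt hit
  have hu := isUnit_iter hg1 (fun i hi => (hg1S _ (hxS' i hi)).2) j le_rfl
  obtain ⟨C, hC⟩ : ∃ C : Cn n →L[ℂ] Cn n, C * fderiv ℂ (g1^[j]) q = T := by
    obtain ⟨w, hw⟩ := hu
    exact ⟨T * ((w⁻¹ : (Cn n →L[ℂ] Cn n)ˣ) : Cn n →L[ℂ] Cn n), by rw [← hw, mul_assoc, Units.inv_mul, mul_one]⟩
  generalize ha : g1^[j] q = a at *
  let c := q - g1 a
  let L := C - fderiv ℂ g1 a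
  obtain ⟨M, hM⟩ := (isCompact_closedBall (0 : Cn n) R).exists_bound_of_continuousOn
    (f := fun z => c + L (z - a)) (by fun_prop)
  obtain ⟨P, hP, hPa, hPa', hPS, hPR⟩ := bump_small S haS hR hj (ε := ε / 4 / (|M| + 1)) (by positivity)
  obtain ⟨k1, k2, k3⟩ := corr hg1 hP a c L
  refine ⟨⟨⟨_, k1.continuous⟩, k1⟩, hRV _ fun z hz => ?_, q, hqB, j + 1, by omega, ?_⟩
  · change dist (eapp f z) (g1 z + P z • (c + L (z - a))) < ε
    have e1 := hg z hz
    have e2 := hg1R z hz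
    have e3 : dist (g1 z) (g1 z + P z • (c + L (z - a))) < ε / 3 := by
      rw [dist_self_add_right, norm_smul]
      have : ‖c + L (z - a)‖ ≤ |M| + 1 := (hM z hz).trans ((le_abs_self _).trans (by linarith))
      calc _ ≤ ε / 4 / (|M| + 1) * (|M| + 1) := by gcongr; exact hPR z hz
        _ = ε / 4 := by field_simp
        _ < _ := by linarith
    have t1 := dist_triangle (eapp f z) (eapp g z) (g1 z)
    have t2 := dist_triangle (eapp f z) (g1 z) (g1 z + P z • (c + L (z - a)))
    linarith
  · change (fun z => g1 z + P z • (c + L (z - a)))^[j + 1] q = q ∧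
      HasFDerivAt ((fun z => g1 z + P z • (c + L (z - a)))^[j + 1]) T q
    have ka := k2 hPa hPa'
    have kv : (fun z => g1 z + P z • (c + L (z - a))) a = q := by simp [hPa, c]
    have kS : ∀ x ∈ S, (fun z => g1 z + P z • (c + L (z - a))) x = g1 x ∧
        HasFDerivAt (fun z => g1 z + P z • (c + L (z - a))) (fderiv ℂ g1 x) x :=
      fun x hx => ⟨by simp [hPS x hx], k3 x (hPS x hx).1 (hPS x hx).2⟩
    generalize (fun z => g1 z + P z • (c + L (z - a))) = h at *
    obtain ⟨c1, c2⟩ := chain_iter hg1 (fun i hi => kS _ (hxS' i hi)) j le_rfl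
    rw [ha] at c1
    rw [Function.iterate_succ', Function.comp_apply, c1]
    refine ⟨kv, ?_⟩
    have e : fderiv ℂ g1 a + L = C := by simp [L]
    rw [e, ← c1] at ka
    rw [← hC]
    exact ka.comp q c2

def hitSet (S : Set (Cn n →L[ℂ] Cn n)) (B : Set (Cn n)) : Set (Endo n) :=
  {h | ∃ q ∈ B, ∃ m, 1 ≤ m ∧ (eapp h)^[m] q = q ∧ fderiv ℂ ((eapp h)^[m]) q ∈ S}

lemma mem_interior_hit (hn : 1 ≤ n) {S : Set (Cn n →L[ℂ] Cn n)} {T : Cn n →L[ℂ] Cn n} (hT : IsUnit (T - 1))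
    (hS : S ∈ 𝓝 T) {B : Set (Cn n)} (hB : IsOpen B) {h : Endo n} {q : Cn n} (hq : q ∈ B) {m : ℕ}
    (hm : 1 ≤ m) (hfix : (eapp h)^[m] q = q) (hd : HasFDerivAt ((eapp h)^[m]) T q) :
    h ∈ interior (hitSet S B) := by
  rw [mem_interior_iff_mem_nhds]
  have := persist hn (iterEndo h m) (q := q) hfix hd hT hS (hB.mem_nhds hq)
  filter_upwards [((iterEndo_cont m).tendsto h).eventually this] with g hg
  obtain ⟨q', hq', h1, h2⟩ := hg
  exact ⟨q', hq', m, hm, h1, h2⟩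

lemma generic_hit (hn : 1 ≤ n) {S : Set (Cn n →L[ℂ] Cn n)} {T : Cn n →L[ℂ] Cn n} (hT : IsUnit (T - 1))
    (hS : S ∈ 𝓝 T) :
    ∀ᶠ f in residual (Endo n), ∀ p ∉ rne f, ∀ B, IsOpen B → p ∈ B → f ∈ hitSet S B := by
  have hres : ∀ᶠ f in residual (Endo n), ∀ B ∈ TopologicalSpace.countableBasis (Cn n),
      f ∈ interior (hitSet S B) ∪ (closure (interior (hitSet S B)))ᶜ := by
    rw [eventually_countable_ball (TopologicalSpace.countable_countableBasis _)]
    intro B hB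
    refine residual_of_dense_open (isOpen_interior.union isClosed_closure.isOpen_compl) ?_
    intro x
    by_cases hx : x ∈ closure (interior (hitSet S B))
    · exact closure_mono Set.subset_union_left hx
    · exact subset_closure (Or.inr hx)
  filter_upwards [hres] with f hf p hp B hB hpB
  obtain ⟨B', hB', hpB', hsub⟩ := (TopologicalSpace.isBasis_countableBasis (Cn n)).exists_subset_of_mem_open hpB hB
  have hopen := TopologicalSpace.isOpen_of_mem_countableBasis hB'
  have hcl : f ∈ closure (interior (hitSet S B')) := by
    rw [mem_closure_iff_nhds]
    intro V hV
    obtain ⟨h, hhV, q, hq, m, hm, h1, h2⟩ := close_up f hp hopen hpB' hV T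
    exact ⟨h, hhV, mem_interior_hit hn hT hS hopen hq hm h1 h2⟩
  rcases hf B' hB' with h | h
  · obtain ⟨q, hq, r⟩ := interior_subset h
    exact ⟨q, hsub hq, r⟩
  · exact absurd hcl h

def repS (n : ℕ) : Set (Cn n →L[ℂ] Cn n) := {A | ∀ z ∈ spectrum ℂ A, 1 < ‖z‖}

def sadS (n : ℕ) : Set (Cn n →L[ℂ] Cn n) :=
  {A | (∀ z ∈ spectrum ℂ A, ‖z‖ ≠ 1) ∧ (∃ z ∈ spectrum ℂ A, ‖z‖ < 1) ∧ ∃ z ∈ spectrum ℂ A, 1 < ‖z‖}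

lemma repS_nhds : repS n ∈ 𝓝 ((3 : ℂ) • (1 : Cn n →L[ℂ] Cn n)) := by
  refine mem_of_superset (ball_mem_nhds _ one_pos) fun A hA z hz => ?_
  obtain ⟨v, hv, hAv⟩ := exists_eigvec hz
  rw [mem_ball, dist_eq_norm] at hA
  have h1 := (A - (3 : ℂ) • (1 : Cn n →L[ℂ] Cn n)).le_opNorm v
  have h2 : (A - (3 : ℂ) • (1 : Cn n →L[ℂ] Cn n)) v = (z - 3) • v := by
    rw [sub_smul, ← hAv]; rfl
  rw [h2, norm_smul] at h1
  have h3 : ‖z - 3‖ < 1 := (le_of_mul_le_mul_right h1 (norm_pos_iff.2 hv)).trans_lt hA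
  have h4 : ‖(3 : ℂ)‖ ≤ ‖z‖ + ‖z - 3‖ := norm_le_norm_add_norm_sub _ _
  rw [Complex.norm_ofNat] at h4
  linarith

lemma rep_unit : IsUnit ((3 : ℂ) • (1 : Cn n →L[ℂ] Cn n) - 1) := by
  have : (3 : ℂ) • (1 : Cn n →L[ℂ] Cn n) - 1 = algebraMap ℂ _ 2 := by
    rw [Algebra.algebraMap_eq_smul_one]
    module
  rw [this]
  exact (IsUnit.mk0 (2 : ℂ) two_ne_zero).map _

def sadT (hn : 1 ≤ n) : Cn n →L[ℂ] Cn n :=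
  (4 : ℂ) • (1 - (EuclideanSpace.proj (⟨0, hn⟩ : Fin n) : Cn n →L[ℂ] ℂ).smulRight
    (EuclideanSpace.single (⟨0, hn⟩ : Fin n) (1 : ℂ)))

lemma sadT_sq (hn : 1 ≤ n) : sadT hn * sadT hn = (4 : ℂ) • sadT hn := by
  ext v i
  simp [sadT]

lemma sad_unit (hn : 1 ≤ n) : IsUnit (sadT hn - 1) := by
  have h := sadT_sq hn
  generalize sadT hn = T at h
  have e1 : (T - 1) * ((3 : ℂ)⁻¹ • (T - (3 : ℂ) • 1)) = 1 := by
    rw [mul_smul_comm, sub_mul, mul_sub, h, mul_smul_comm, one_mul, mul_one]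
    module
  have e2 : ((3 : ℂ)⁻¹ • (T - (3 : ℂ) • 1)) * (T - 1) = 1 := by
    rw [smul_mul_assoc, sub_mul, mul_sub, h, smul_mul_assoc, one_mul, mul_one]
    module
  exact ⟨⟨_, _, e1, e2⟩, rfl⟩

lemma mem_spec_root {A : Cn n →L[ℂ] Cn n} {z : ℂ} (h : z ∈ (A : Cn n →ₗ[ℂ] Cn n).charpoly.roots) :
    z ∈ spectrum ℂ A := by
  have h2 := AlgEquiv.spectrum_eq (Module.End.toContinuousLinearMap (𝕜 := ℂ) (Cn n)) (A : Cn n →ₗ[ℂ] Cn n)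
  have h3 : spectrum ℂ A = spectrum ℂ (A : Cn n →ₗ[ℂ] Cn n) := h2
  rw [h3, Module.End.mem_spectrum_iff_isRoot_charpoly]
  exact Polynomial.isRoot_of_mem_roots h

lemma one_le_prod (s : Multiset ℂ) (h : ∀ z ∈ s, 1 ≤ ‖z‖) : 1 ≤ ‖s.prod‖ := by
  induction s using Multiset.induction_on with
  | empty => simp
  | cons a s ih =>
    rw [Multiset.prod_cons, norm_mul]
    exact one_le_mul_of_one_le_of_one_le (h a (by simp)) (ih fun z hz => h z (by simp [hz]))

lemma small_of_det {A : Cn n →L[ℂ] Cn n} (h : ‖A.det‖ < 1) : ∃ z ∈ spectrum ℂ A, ‖z‖ < 1 := by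
  by_contra! hcon
  have e : A.det = (A : Cn n →ₗ[ℂ] Cn n).charpoly.roots.prod :=
    Module.End.det_eq_prod_roots_charpoly_of_splits (IsAlgClosed.splits _)
  rw [e] at h
  exact absurd (one_le_prod _ fun z hz => hcon z (mem_spec_root hz)) (not_le.2 h)

lemma sum_le_card (s : Multiset ℂ) (h : ∀ z ∈ s, ‖z‖ ≤ 1) : ‖s.sum‖ ≤ Multiset.card s := by
  induction s using Multiset.induction_on with
  | empty => simp
  | cons a s ih =>
    rw [Multiset.sum_cons, Multiset.card_cons]
    push_cast
    have := norm_add_le a s.sum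
    have h1 := h a (by simp)
    have h2 := ih fun z hz => h z (by simp [hz])
    linarith

lemma big_of_trace {A : Cn n →L[ℂ] Cn n} (h : (n : ℝ) < ‖LinearMap.trace ℂ (Cn n) (A : Cn n →ₗ[ℂ] Cn n)‖) :
    ∃ z ∈ spectrum ℂ A, 1 < ‖z‖ := by
  by_contra! hcon
  rw [Module.End.trace_eq_sum_roots_charpoly_of_splits (IsAlgClosed.splits _)] at h
  have h1 := sum_le_card _ fun z hz => hcon z (mem_spec_root (A := A) hz)
  have h2 := (A : Cn n →ₗ[ℂ] Cn n).charpoly.card_roots'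
  rw [LinearMap.charpoly_natDegree, finrank_euclideanSpace_fin] at h2
  have h3 : ((Multiset.card (A : Cn n →ₗ[ℂ] Cn n).charpoly.roots : ℕ) : ℝ) ≤ n := by exact_mod_cast h2
  linarith

lemma sadT_det (hn : 1 ≤ n) : (sadT hn).det = 0 := by
  change LinearMap.det (sadT hn : Cn n →ₗ[ℂ] Cn n) = 0
  rw [LinearMap.det_eq_zero_iff_ker_ne_bot, Submodule.ne_bot_iff]
  refine ⟨EuclideanSpace.single (⟨0, hn⟩ : Fin n) (1 : ℂ), ?_, ?_⟩
  · rw [LinearMap.mem_ker]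
    change sadT hn _ = 0
    simp [sadT]
  · simp

lemma sadT_trace (hn : 1 ≤ n) :
    LinearMap.trace ℂ (Cn n) (sadT hn : Cn n →ₗ[ℂ] Cn n) = 4 * ((n : ℂ) - 1) := by
  have e : (sadT hn : Cn n →ₗ[ℂ] Cn n) = (4 : ℂ) • (1 -
      LinearMap.smulRight ((EuclideanSpace.proj (⟨0, hn⟩ : Fin n) : Cn n →L[ℂ] ℂ) : Cn n →ₗ[ℂ] ℂ)
      (EuclideanSpace.single (⟨0, hn⟩ : Fin n) (1 : ℂ))) := rfl
  rw [e, map_smul, map_sub, LinearMap.trace_one, LinearMap.trace_smulRight, finrank_euclideanSpace_fin]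
  simp

lemma sadS_nhds (hn : 2 ≤ n) : sadS n ∈ 𝓝 (sadT (one_le_two.trans hn)) := by
  have hsq := sadT_sq (one_le_two.trans hn)
  have hdet := sadT_det (one_le_two.trans hn)
  have htr := sadT_trace (one_le_two.trans hn)
  generalize sadT (one_le_two.trans hn) = T at *
  have h1 : ∀ᶠ A : Cn n →L[ℂ] Cn n in 𝓝 T, ‖A.det‖ < 1 := by
    have : Continuous fun A : Cn n →L[ℂ] Cn n => ‖A.det‖ := ContinuousLinearMap.continuous_det.norm
    exact this.continuousAt.eventually_lt_const (by simp [hdet])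
  have h2 : ∀ᶠ A : Cn n →L[ℂ] Cn n in 𝓝 T,
      (n : ℝ) < ‖LinearMap.trace ℂ (Cn n) (A : Cn n →ₗ[ℂ] Cn n)‖ := by
    have : Continuous fun A : Cn n →L[ℂ] Cn n => ‖LinearMap.trace ℂ (Cn n) (A : Cn n →ₗ[ℂ] Cn n)‖ :=
      (((LinearMap.trace ℂ (Cn n)).comp (ContinuousLinearMap.coeLM ℂ)).continuous_of_finiteDimensional).norm
    refine this.continuousAt.eventually_const_lt ?_
    beta_reduce
    rw [htr]
    have e : (4 * ((n : ℂ) - 1)) = ((4 * ((n : ℝ) - 1) : ℝ) : ℂ) := by push_cast; ring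
    have hn' : (2 : ℝ) ≤ n := by exact_mod_cast hn
    rw [e, Complex.norm_real, Real.norm_eq_abs, abs_of_nonneg (by linarith)]
    linarith
  let D : Cn n →L[ℂ] Cn n := T - (4 : ℂ) • 1
  have h3 : ∀ᶠ A : Cn n →L[ℂ] Cn n in 𝓝 T, ‖A - T‖ * (1 + ‖D‖) < 3 := by
    have : Continuous fun A : Cn n →L[ℂ] Cn n => ‖A - T‖ * (1 + ‖D‖) := by fun_prop
    exact this.continuousAt.eventually_lt_const (by simp)
  filter_upwards [h1, h2, h3] with A hA1 hA2 hA3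
  refine ⟨fun z hz hz1 => ?_, small_of_det hA1, big_of_trace hA2⟩
  obtain ⟨v, hv, hAv⟩ := exists_eigvec hz
  have hv' := norm_pos_iff.2 hv
  have hTT : T (T v) = (4 : ℂ) • T v := by
    have := congrArg (fun X : Cn n →L[ℂ] Cn n => X v) hsq
    exact this
  have key : z • ((A - T) v) + D ((A - T) v) = (z * (z - 4)) • v := by
    simp only [D, sub_apply, hAv, smul_apply, one_apply_eq_self, map_sub, map_smul, hTT]
    module
  have hlow : 3 ≤ ‖z * (z - 4)‖ := by
    rw [norm_mul, hz1, one_mul]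
    have := norm_le_norm_add_norm_sub z (4 : ℂ)
    rw [Complex.norm_ofNat] at this
    linarith
  have hup : ‖(z * (z - 4)) • v‖ ≤ (‖A - T‖ * (1 + ‖D‖)) * ‖v‖ := by
    rw [← key]
    refine (norm_add_le _ _).trans ?_
    rw [norm_smul, hz1, one_mul]
    have i1 := (A - T).le_opNorm v
    have i2 := D.le_opNorm ((A - T) v)
    have i3 : ‖D‖ * ‖(A - T) v‖ ≤ ‖D‖ * (‖A - T‖ * ‖v‖) := by gcongr
    linarith
  rw [norm_smul] at hup
  linarith [le_of_mul_le_mul_right hup hv']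

lemma spec_pow {f : Endo n} {p : Cn n} {m : ℕ} (hm : 1 ≤ m) (hp : (eapp f)^[m] p = p) :
    ∃ t : ℕ, 0 < t ∧ spectrum ℂ (fderiv ℂ ((eapp f)^[m]) p) = (· ^ t) '' eigs f p := by
  have hper : Function.IsPeriodicPt (eapp f) m p := hp
  obtain ⟨t, ht⟩ := hper.minimalPeriod_dvd
  have hk : (eapp f)^[minPer f p] p = p := Function.isPeriodicPt_minimalPeriod _ _
  have ht0 : 0 < t := by
    rcases Nat.eq_zero_or_pos t with h | h
    · subst h; omega
    · exact h
  refine ⟨t, ht0, ?_⟩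
  have e : m = minPer f p * t := ht
  rw [e, fderiv_iter_mul hk, spectrum.map_pow_of_pos _ ht0]
  rfl

lemma rep_of_hit {f : Endo n} {p : Cn n} {m : ℕ} (hm : 1 ≤ m) (hp : (eapp f)^[m] p = p)
    (h : fderiv ℂ ((eapp f)^[m]) p ∈ repS n) : p ∈ repSet f := by
  obtain ⟨t, ht, e⟩ := spec_pow hm hp
  refine ⟨⟨m, hm, hp⟩, fun z hz => ?_⟩
  have h1 : 1 < ‖z ^ t‖ := h _ (by rw [e]; exact ⟨z, hz, rfl⟩)
  rw [norm_pow] at h1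
  by_contra hcon
  exact absurd (pow_le_one₀ (norm_nonneg z) (not_lt.1 hcon)) (not_le.2 h1)

lemma sad_of_hit {f : Endo n} {p : Cn n} {m : ℕ} (hm : 1 ≤ m) (hp : (eapp f)^[m] p = p)
    (h : fderiv ℂ ((eapp f)^[m]) p ∈ sadS n) : p ∈ sadSet f := by
  obtain ⟨t, ht, e⟩ := spec_pow hm hp
  obtain ⟨h0, ⟨w1, hw1, hlt⟩, ⟨w2, hw2, hgt⟩⟩ := h
  rw [e] at hw1 hw2
  obtain ⟨z1, hz1, rfl⟩ := hw1
  obtain ⟨z2, hz2, rfl⟩ := hw2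
  simp only [norm_pow] at hlt hgt
  refine ⟨⟨⟨m, hm, hp⟩, fun z hz hz1 => ?_⟩, ⟨z1, hz1, ?_⟩, ⟨z2, hz2, ?_⟩⟩
  · exact h0 (z ^ t) (by rw [e]; exact ⟨z, hz, rfl⟩) (by rw [norm_pow, hz1, one_pow])
  · by_contra hcon
    exact absurd (one_le_pow₀ (not_lt.1 hcon)) (not_le.2 hlt)
  · by_contra hcon
    exact absurd (pow_le_one₀ (norm_nonneg z2) (not_lt.1 hcon)) (not_le.2 hgt)

lemma exp_data {f : Endo n} {p : Cn n} (hp : IsPer f p) (h : ∃ z ∈ eigs f p, 1 < ‖z‖) (m : ℕ) (hm : 1 ≤ m) :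
    p ∈ Julia (iterEndo f m) := by
  obtain ⟨z, hz, hz1⟩ := h
  obtain ⟨k, hk, hkp⟩ := hp
  have hper : p ∈ Function.periodicPts (eapp f) := ⟨k, hk, hkp⟩
  have hpos : 1 ≤ minPer f p := Function.minimalPeriod_pos_of_mem_periodicPts hper
  have hfix : (eapp f)^[minPer f p] p = p := Function.isPeriodicPt_minimalPeriod _ _
  have hzm : z ^ m ∈ spectrum ℂ (fderiv ℂ ((eapp (iterEndo f m))^[minPer f p]) p) := by
    rw [iter_iter, mul_comm, fderiv_iter_mul hfix, spectrum.map_pow_of_pos _ hm]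
    exact ⟨z, hz, rfl⟩
  obtain ⟨v, hv, hAv⟩ := exists_eigvec hzm
  refine expand_julia hpos ?_ hv ?_ hAv
  · rw [iter_iter, mul_comm, Function.iterate_mul]
    exact Function.iterate_fixed hfix m
  · rw [norm_pow]
    exact one_lt_pow₀ hz1 (by omega)

lemma iterEndo_one (f : Endo n) : iterEndo f 1 = f := by
  apply Subtype.ext; ext; rfl

lemma rep_exp (hn : 1 ≤ n) {f : Endo n} {p : Cn n} (hp : p ∈ repSet f) : ∃ z ∈ eigs f p, 1 < ‖z‖ := by
  have : Nonempty (Fin n) := ⟨⟨0, hn⟩⟩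
  have : Nontrivial (Cn n) := (WithLp.equiv 2 (Fin n → ℂ)).nontrivial
  obtain ⟨z, hz⟩ := spectrum.nonempty_of_isAlgClosed_of_finiteDimensional ℂ
    (fderiv ℂ ((eapp f)^[minPer f p]) p)
  exact ⟨z, hz, hp.2 z hz⟩

/-- For a generic endomorphism `f` of `ℂⁿ`: `J_f` is the closure of `rep(f)` (and of `sad(f)`
when `n ≥ 2`), and every iterate `f^[m]`, `m ≥ 2`, has the same Fatou and Julia sets as `f`. -/
theorem stmt_11 (n : ℕ) (hn : 1 ≤ n) :
    {f : Endo n | Julia f = closure (repSet f) ∧ (2 ≤ n → Julia f = closure (sadSet f)) ∧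
      ∀ m : ℕ, 2 ≤ m → Fatou (iterEndo f m) = Fatou f ∧ Julia (iterEndo f m) = Julia f}
      ∈ residual (Endo n) := by
  have hrep := generic_hit hn (rep_unit (n := n)) repS_nhds
  have hsad : ∀ᶠ f in residual (Endo n), 2 ≤ n → ∀ p ∉ rne f, ∀ B, IsOpen B → p ∈ B → f ∈ hitSet (sadS n) B := by
    by_cases h2 : 2 ≤ n
    · filter_upwards [generic_hit hn (sad_unit (one_le_two.trans h2)) (sadS_nhds h2)] with f hf _
      exact hf
    · exact Eventually.of_forall fun f h => absurd h h2
  filter_upwards [hrep, hsad] with f hf hs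
  have hJ : ∀ p ∈ Julia f, p ∉ rne f := fun p hp h => hp (rne_sub_fatou f h)
  have e1 : Julia f ⊆ closure (repSet f) := by
    intro p hp
    rw [_root_.mem_closure_iff]
    intro B hB hpB
    obtain ⟨q, hq, m, hm, h1, h2⟩ := hf p (hJ p hp) B hB hpB
    exact ⟨q, hq, rep_of_hit hm h1 h2⟩
  have e2 : ∀ m, 1 ≤ m → closure (repSet f) ⊆ Julia (iterEndo f m) := fun m hm =>
    closure_minimal (fun p hp => exp_data hp.1 (rep_exp hn hp) m hm) (julia_closed _)
  have e2' := e2 1 le_rfl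
  rw [iterEndo_one] at e2'
  refine ⟨e1.antisymm e2', fun h2 => Set.Subset.antisymm ?_ ?_, fun m hm => ?_⟩
  · intro p hp
    rw [_root_.mem_closure_iff]
    intro B hB hpB
    obtain ⟨q, hq, m, hm, h1, h3⟩ := hs h2 p (hJ p hp) B hB hpB
    exact ⟨q, hq, sad_of_hit hm h1 h3⟩
  · refine closure_minimal (fun p hp => ?_) (julia_closed _)
    have := exp_data hp.1.1 hp.2.2 1 le_rfl
    rwa [iterEndo_one] at this
  · have hF : Fatou (iterEndo f m) = Fatou f := by
      refine Set.Subset.antisymm ?_ (fatou_sub_iter f (by omega))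
      exact Set.compl_subset_compl.1 (e1.trans (e2 m (by omega)))
    exact ⟨hF, by rw [Julia, Julia, hF]⟩
end
end
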